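/- Let t ≥ 2 and k ≥ 1 be integers. For every algebraic number α with 0 < |α| < 1, one has H_k(α^{t^k}) ≠ 0 and the quotient H_k(α)/H_k(α^{t^k}) is a transcendental number. -/

import Mathlib

open Polynomial

/-- The (Type 1) Stern polynomials `a_t(n; z) ∈ ℤ[z]` of Dilcher and Eriksen:
`a_t(0;z) = 0`, `a_t(1;z) = 1`, and for `n ≥ 1`,
`a_t(2n;z) = z·a_t(n;z^t)`, `a_t(2n+1;z) = a_t(n+1;z^t) + a_t(n;z^t)`. -/
noncomputable def sternPoly (t : ℕ) : ℕ → Polynomial ℤ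
  | 0 => 0
  | 1 => 1
  | n + 2 =>
    if h : (n + 2) % 2 = 0 then
      X * (sternPoly t ((n + 2) / 2)).comp (X ^ t)
    else
      (sternPoly t ((n + 2) / 2 + 1)).comp (X ^ t) +
        (sternPoly t ((n + 2) / 2)).comp (X ^ t)
decreasing_by all_goals omega

/-- `α_n = (2^{kn} - (-1)^n) / (2^k + 1)`, a nonnegative integer. -/
def sternAlpha (k n : ℕ) : ℕ :=
  (((2 : ℤ) ^ (k * n) - (-1) ^ n) / (2 ^ k + 1)).toNat


namespace HkAux

def eS (t : ℕ) : ℕ → ℕ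
  | 0 => 0
  | j + 1 => 1 + t * eS t j

noncomputable def pS (t : ℕ) : ℕ → Polynomial ℤ
  | 0 => 0
  | j + 1 => (pS t j).comp (X ^ t) + X ^ (t * eS t j)

lemma stern_even (t n : ℕ) : sternPoly t (2 * n) = X * (sternPoly t n).comp (X ^ t) := by
  rcases n with _ | n
  · simp [sternPoly]
  · have : 2 * (n + 1) = 2 * n + 2 := by ring
    rw [this, sternPoly]
    have h2 : (2 * n + 2) / 2 = n + 1 := by omega
    simp [h2]

lemma stern_odd (t n : ℕ) : sternPoly t (2 * n + 1) =
    (sternPoly t (n + 1)).comp (X ^ t) + (sternPoly t n).comp (X ^ t) := by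
  rcases n with _ | n
  · simp [sternPoly]
  · have : 2 * (n + 1) + 1 = (2 * n + 1) + 2 := by ring
    rw [this, sternPoly]
    have h2 : (2 * n + 1 + 2) / 2 = n + 1 := by omega
    have h3 : ¬ (2 * n + 1 + 2) % 2 = 0 := by omega
    rw [dif_neg h3, h2]

lemma comp_XX (p : ℤ[X]) (a b : ℕ) : (p.comp (X ^ a)).comp (X ^ b) = p.comp (X ^ (a * b)) := by
  rw [comp_assoc]; simp [← pow_mul, mul_comm]

lemma stern_pow (t m j : ℕ) : sternPoly t (2 ^ j * m) =
    X ^ eS t j * (sternPoly t m).comp (X ^ t ^ j) := by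
  induction j with
  | zero => simp [eS]
  | succ j ih =>
    rw [show 2 ^ (j + 1) * m = 2 * (2 ^ j * m) by ring, stern_even, ih, mul_comp, comp_XX]
    simp [eS]
    ring_nf

lemma stern_plus (t m j : ℕ) : sternPoly t (2 ^ j * m + 1) =
    (sternPoly t (m + 1)).comp (X ^ t ^ j) + pS t j * (sternPoly t m).comp (X ^ t ^ j) := by
  induction j with
  | zero => simp [pS]
  | succ j ih =>
    rw [show 2 ^ (j + 1) * m + 1 = 2 * (2 ^ j * m) + 1 by ring, stern_odd, ih, stern_pow]
    simp only [add_comp, mul_comp, comp_XX, pS, pow_succ, X_pow_comp, ← pow_mul]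
    ring

lemma stern_minus (t m j : ℕ) (hm : 1 ≤ m) : sternPoly t (2 ^ j * m - 1) =
    (sternPoly t (m - 1)).comp (X ^ t ^ j) + pS t j * (sternPoly t m).comp (X ^ t ^ j) := by
  induction j with
  | zero => simp [pS]
  | succ j ih =>
    have h1 : 1 ≤ 2 ^ j * m := Nat.mul_pos (by positivity) hm
    rw [show 2 ^ (j + 1) * m - 1 = 2 * (2 ^ j * m - 1) + 1 by rw [pow_succ, mul_right_comm]; omega,
      stern_odd, Nat.sub_add_cancel h1, ih, stern_pow]
    simp only [add_comp, mul_comp, comp_XX, pS, pow_succ, X_pow_comp, ← pow_mul]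
    ring

/-- recursive integer version of the sequence -/
def aI (k : ℕ) : ℕ → ℤ
  | 0 => 0
  | n + 1 => 2 ^ k * aI k n + (-1) ^ n

lemma aI_eq (k n : ℕ) : (2 ^ k + 1) * aI k n = (2 : ℤ) ^ (k * n) - (-1) ^ n := by
  induction n with
  | zero => simp [aI]
  | succ n ih =>
    rw [aI, mul_add, mul_left_comm, ih, mul_add k n 1, pow_add, pow_succ (-1 : ℤ)]
    simp
    ring

lemma aI_nonneg (k n : ℕ) : 0 ≤ aI k n := by
  have h := aI_eq k n
  have h1 : (-1 : ℤ) ^ n ≤ 1 := by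
    rcases neg_one_pow_eq_or ℤ n with h | h <;> rw [h] <;> norm_num
  have h2 : (1 : ℤ) ≤ 2 ^ (k * n) := one_le_pow₀ (by norm_num)
  have h3 : (0 : ℤ) < 2 ^ k + 1 := by positivity
  by_contra hc
  push Not at hc
  nlinarith

lemma alpha_eq (k n : ℕ) : (sternAlpha k n : ℤ) = aI k n := by
  have h3 : (2 ^ k + 1 : ℤ) ≠ 0 := by positivity
  rw [sternAlpha, ← aI_eq, Int.mul_ediv_cancel_left _ h3, Int.toNat_of_nonneg (aI_nonneg k n)]

lemma stern_rec (t k n : ℕ) :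
    sternPoly t (sternAlpha k (n + 2)) =
      pS t k * (sternPoly t (sternAlpha k (n + 1))).comp (X ^ t ^ k) +
      X ^ (t ^ k * eS t k) * (sternPoly t (sternAlpha k n)).comp (X ^ (t ^ k * t ^ k)) := by
  have e1 := alpha_eq k (n + 1)
  have e2 := alpha_eq k (n + 2)
  have e0 := alpha_eq k n
  rw [aI, ← e0] at e1
  rw [aI, aI, ← e0, ← e1] at e2
  rcases Nat.even_or_odd n with hn | hn
  · -- alpha (n+1) = 2^k alpha n + 1, alpha (n+2) = 2^k alpha (n+1) - 1
    have s1 : sternAlpha k (n + 1) = 2 ^ k * sternAlpha k n + 1 := by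
      rw [hn.neg_one_pow] at e1; exact_mod_cast e1
    have s2 : sternAlpha k (n + 2) = 2 ^ k * sternAlpha k (n + 1) - 1 := by
      rw [pow_succ, hn.neg_one_pow] at e2
      have : (sternAlpha k (n + 2) : ℤ) + 1 = 2 ^ k * sternAlpha k (n + 1) := by rw [e2]; ring
      have : sternAlpha k (n + 2) + 1 = 2 ^ k * sternAlpha k (n + 1) := by exact_mod_cast this
      omega
    rw [s2, stern_minus _ _ _ (by omega)]
    have s3 : sternAlpha k (n + 1) - 1 = 2 ^ k * sternAlpha k n := by omega
    rw [s3, stern_pow, mul_comp, comp_XX, X_pow_comp, ← pow_mul]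
    ring
  · have s1 : sternAlpha k (n + 1) + 1 = 2 ^ k * sternAlpha k n := by
      rw [hn.neg_one_pow] at e1
      have : (sternAlpha k (n + 1) : ℤ) + 1 = 2 ^ k * sternAlpha k n := by rw [e1]; ring
      exact_mod_cast this
    have s2 : sternAlpha k (n + 2) = 2 ^ k * sternAlpha k (n + 1) + 1 := by
      rw [pow_succ, hn.neg_one_pow] at e2
      have : (sternAlpha k (n + 2) : ℤ) = 2 ^ k * sternAlpha k (n + 1) + 1 := by rw [e2]; ring
      exact_mod_cast this
    rw [s2, stern_plus, s1, stern_pow, mul_comp, comp_XX, X_pow_comp, ← pow_mul]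
    ring

lemma stern_zero (t k : ℕ) : sternPoly t (sternAlpha k 0) = 0 := by
  have : sternAlpha k 0 = 0 := by simp [sternAlpha]
  rw [this, sternPoly]

lemma stern_one (t k : ℕ) : sternPoly t (sternAlpha k 1) = 1 := by
  have e1 := alpha_eq k 1
  simp [aI] at e1
  rw [e1, sternPoly]

lemma eS_pos (t k : ℕ) (hk : 1 ≤ k) : 1 ≤ eS t k := by
  obtain ⟨k, rfl⟩ := Nat.exists_eq_add_of_le' hk
  rw [eS]; omega

lemma pS_deg (t k : ℕ) : (pS t k).natDegree ≤ eS t k - 1 := by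
  induction k with
  | zero => simp [pS]
  | succ k ih =>
    rw [pS, eS, Nat.add_sub_cancel_left]
    refine (natDegree_add_le _ _).trans (max_le ?_ (natDegree_X_pow_le _))
    refine natDegree_comp_le.trans ?_
    rw [natDegree_X_pow, mul_comm]
    exact Nat.mul_le_mul_left _ (ih.trans (Nat.sub_le _ _))

lemma pS_one (t k : ℕ) : (pS t k).eval 1 = k := by
  induction k with
  | zero => simp [pS]
  | succ k ih => simp [pS, ih]

lemma pS_zero (t k : ℕ) (ht : 2 ≤ t) (hk : 1 ≤ k) : (pS t k).eval 0 = 1 := by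
  induction k, hk using Nat.le_induction with
  | base => simp [pS, eS]
  | succ k hk ih =>
    have h := eS_pos t k hk
    rw [pS, eval_add, eval_comp, eval_pow, eval_X, zero_pow (by omega), ih, eval_pow, eval_X,
      zero_pow (by positivity), add_zero]

lemma comp_nonneg (p : ℤ[X]) (hp : ∀ i, 0 ≤ p.coeff i) (m : ℕ) (hm : 1 ≤ m) (i : ℕ) :
    0 ≤ (p.comp (X ^ m)).coeff i := by
  rw [← expand_eq_comp_X_pow, coeff_expand (by omega)]
  split_ifs
  · exact hp _
  · exact le_rfl

lemma mul_nonneg_coeff (p q : ℤ[X]) (hp : ∀ i, 0 ≤ p.coeff i) (hq : ∀ i, 0 ≤ q.coeff i) (i : ℕ) :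
    0 ≤ (p * q).coeff i := by
  rw [coeff_mul]
  exact Finset.sum_nonneg fun x _ => mul_nonneg (hp _) (hq _)

lemma pow_nonneg_coeff (n i : ℕ) : 0 ≤ ((X : ℤ[X]) ^ n).coeff i := by
  rw [coeff_X_pow]; split_ifs <;> norm_num

lemma pS_nonneg (t k : ℕ) (ht : 2 ≤ t) (i : ℕ) : 0 ≤ (pS t k).coeff i := by
  induction k generalizing i with
  | zero => simp [pS]
  | succ k ih =>
    rw [pS, coeff_add]
    exact add_nonneg (comp_nonneg _ ih _ (by omega) _) (pow_nonneg_coeff _ _)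

section series

variable {T e : ℕ} {Q : ℤ[X]} {f : ℕ → ℤ[X]}

lemma f_nonneg (hT : 2 ≤ T)
    (hQn : ∀ i, 0 ≤ Q.coeff i) (hQ0 : Q.coeff 0 = 1) (f0 : f 0 = 0) (f1 : f 1 = 1)
    (hf : ∀ n, f (n + 2) = Q * (f (n + 1)).comp (X ^ T) + X ^ (T * e) * (f n).comp (X ^ (T * T)))
    (n : ℕ) : ∀ i, 0 ≤ (f (n + 1) - f n).coeff i := by
  have hTT : 1 ≤ T * T := by nlinarith
  induction n using Nat.twoStepInduction with
  | zero => intro i; simp [f0, f1, coeff_one]; split_ifs <;> norm_num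
  | one =>
    intro i
    rw [hf, f0, f1]
    rcases i with _ | i
    · simp [hQ0]
    · simpa [coeff_one] using hQn (i + 1)
  | more n ih1 ih2 =>
    intro i
    have : f (n + 2 + 1) - f (n + 2) = Q * (f (n + 1 + 1) - f (n + 1)).comp (X ^ T) +
        X ^ (T * e) * (f (n + 1) - f n).comp (X ^ (T * T)) := by
      rw [show n + 2 + 1 = (n + 1) + 2 by ring, hf (n + 1), hf n, sub_comp, sub_comp]
      ring
    rw [this, coeff_add]
    exact add_nonneg (mul_nonneg_coeff _ _ hQn (comp_nonneg _ ih2 _ (by omega)) _)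
      (mul_nonneg_coeff _ _ (pow_nonneg_coeff _) (comp_nonneg _ ih1 _ hTT) _)

lemma comp_dvd (p : ℤ[X]) (n m : ℕ) (h : X ^ n ∣ p) : X ^ (m * n) ∣ p.comp (X ^ m) := by
  obtain ⟨q, rfl⟩ := h
  rw [mul_comp, X_pow_comp, ← pow_mul]
  exact dvd_mul_right _ _

lemma f_dvd (hT : 2 ≤ T) (he : 1 ≤ e) (hQ0 : Q.coeff 0 = 1) (f0 : f 0 = 0) (f1 : f 1 = 1)
    (hf : ∀ n, f (n + 2) = Q * (f (n + 1)).comp (X ^ T) + X ^ (T * e) * (f n).comp (X ^ (T * T)))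
    (n : ℕ) : X ^ n ∣ f (n + 1) - f n := by
  have hTe : 2 ≤ T * e := by nlinarith
  induction n using Nat.twoStepInduction with
  | zero => simp
  | one =>
    rw [hf, f0, f1, pow_one, X_dvd_iff]
    simp [hQ0]
  | more n ih1 ih2 =>
    have : f (n + 2 + 1) - f (n + 2) = Q * (f (n + 1 + 1) - f (n + 1)).comp (X ^ T) +
        X ^ (T * e) * (f (n + 1) - f n).comp (X ^ (T * T)) := by
      rw [show n + 2 + 1 = (n + 1) + 2 by ring, hf (n + 1), hf n, sub_comp, sub_comp]
      ring
    rw [this]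
    refine dvd_add (Dvd.dvd.mul_left ?_ _) ?_
    · exact (pow_dvd_pow _ (by nlinarith)).trans (comp_dvd _ _ T ih2)
    · have h3 := mul_dvd_mul_left (X ^ (T * e) : ℤ[X]) (comp_dvd _ _ (T * T) ih1)
      rw [← pow_add] at h3
      refine (pow_dvd_pow _ ?_).trans h3
      nlinarith [Nat.zero_le (T * T * n), mul_le_mul' hT hT]

lemma f_stab (hT : 2 ≤ T) (he : 1 ≤ e) (hQ0 : Q.coeff 0 = 1) (f0 : f 0 = 0) (f1 : f 1 = 1)
    (hf : ∀ n, f (n + 2) = Q * (f (n + 1)).comp (X ^ T) + X ^ (T * e) * (f n).comp (X ^ (T * T)))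
    (i n : ℕ) (h : i < n) : (f n).coeff i = (f (i + 1)).coeff i := by
  induction n, h using Nat.le_induction with
  | base => rfl
  | succ n hn ih =>
    rw [← ih]
    have := (X_pow_dvd_iff.1 (f_dvd hT he hQ0 f0 f1 hf n)) i hn
    rw [coeff_sub] at this
    linarith

/-- the limit power series -/
noncomputable def hS (f : ℕ → ℤ[X]) : PowerSeries ℤ := PowerSeries.mk fun i => (f (i + 1)).coeff i

lemma hS_dvd (hT : 2 ≤ T) (he : 1 ≤ e) (hQ0 : Q.coeff 0 = 1) (f0 : f 0 = 0) (f1 : f 1 = 1)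
    (hf : ∀ n, f (n + 2) = Q * (f (n + 1)).comp (X ^ T) + X ^ (T * e) * (f n).comp (X ^ (T * T)))
    (n : ℕ) : (PowerSeries.X : PowerSeries ℤ) ^ n ∣ hS f - (f n : PowerSeries ℤ) := by
  rw [PowerSeries.X_pow_dvd_iff]
  intro i hi
  rw [map_sub, hS, PowerSeries.coeff_mk, Polynomial.coeff_coe, f_stab hT he hQ0 f0 f1 hf i n hi,
    sub_self]

lemma expand_coe {R : Type*} [CommRing R] (p : R[X]) (m : ℕ) (hm : m ≠ 0) :
    PowerSeries.expand m hm (p : PowerSeries R) = ((p.comp (X ^ m) : R[X]) : PowerSeries R) := by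
  ext i
  rw [PowerSeries.coeff_expand, Polynomial.coeff_coe, Polynomial.coeff_coe,
    ← expand_eq_comp_X_pow, Polynomial.coeff_expand (Nat.pos_of_ne_zero hm)]

lemma expand_dvd {R : Type*} [CommRing R] (p : PowerSeries R) (n m : ℕ) (hm : m ≠ 0)
    (h : PowerSeries.X ^ n ∣ p) : PowerSeries.X ^ n ∣ PowerSeries.expand m hm p := by
  obtain ⟨q, rfl⟩ := h
  rw [map_mul, map_pow, PowerSeries.expand_X, ← pow_mul]
  exact Dvd.dvd.mul_right (pow_dvd_pow _ (Nat.le_mul_of_pos_left _ (Nat.pos_of_ne_zero hm))) _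

lemma hS_eq (hT : 2 ≤ T) (he : 1 ≤ e) (hQ0 : Q.coeff 0 = 1) (f0 : f 0 = 0) (f1 : f 1 = 1)
    (hf : ∀ n, f (n + 2) = Q * (f (n + 1)).comp (X ^ T) + X ^ (T * e) * (f n).comp (X ^ (T * T)))
    (hT0 : T ≠ 0) :
    hS f = (Q : PowerSeries ℤ) * PowerSeries.expand T hT0 (hS f) + PowerSeries.X ^ (T * e) *
      PowerSeries.expand T hT0 (PowerSeries.expand T hT0 (hS f)) := by
  rw [← sub_eq_zero]
  set D := hS f - ((Q : PowerSeries ℤ) * PowerSeries.expand T hT0 (hS f) + PowerSeries.X ^ (T * e) *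
      PowerSeries.expand T hT0 (PowerSeries.expand T hT0 (hS f))) with hD
  have key : ∀ n, (PowerSeries.X : PowerSeries ℤ) ^ n ∣ D := by
    intro n
    have h2 := hS_dvd hT he hQ0 f0 f1 hf (n + 2)
    have h1 := hS_dvd hT he hQ0 f0 f1 hf (n + 1)
    have h0 := hS_dvd hT he hQ0 f0 f1 hf n
    have e2 : (f (n + 2) : PowerSeries ℤ) = (Q : PowerSeries ℤ) * PowerSeries.expand T hT0 (f (n + 1) : PowerSeries ℤ) +
        PowerSeries.X ^ (T * e) * PowerSeries.expand T hT0 (PowerSeries.expand T hT0 (f n : PowerSeries ℤ)) := by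
      rw [expand_coe, expand_coe, expand_coe, comp_XX, hf]
      simp
    have : D = (hS f - (f (n + 2) : PowerSeries ℤ)) -
        (Q : PowerSeries ℤ) * PowerSeries.expand T hT0 (hS f - (f (n + 1) : PowerSeries ℤ)) -
        PowerSeries.X ^ (T * e) * PowerSeries.expand T hT0 (PowerSeries.expand T hT0
          (hS f - (f n : PowerSeries ℤ))) := by
      rw [hD, e2]; simp only [map_sub]; ring
    rw [this]
    refine dvd_sub (dvd_sub ?_ ?_) ?_
    · exact (pow_dvd_pow _ (by omega)).trans h2
    · exact Dvd.dvd.mul_left (expand_dvd _ _ _ _ ((pow_dvd_pow _ (by omega)).trans h1)) _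
    · exact Dvd.dvd.mul_left (expand_dvd _ _ _ _ (expand_dvd _ _ _ _ h0)) _
  ext i
  exact (PowerSeries.X_pow_dvd_iff.1 (key (i + 1))) i (Nat.lt_succ_self i)

/-- absolutely convergent evaluation -/
def Ev (p : PowerSeries ℂ) (z v : ℂ) : Prop :=
  Summable (fun n => ‖PowerSeries.coeff n p * z ^ n‖) ∧ ∑' n, PowerSeries.coeff n p * z ^ n = v

lemma Ev.mul {p q : PowerSeries ℂ} {z v w : ℂ} (hp : Ev p z v) (hq : Ev q z w) :
    Ev (p * q) z (v * w) := by
  have key : ∀ n, PowerSeries.coeff n (p * q) * z ^ n =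
      ∑ kl ∈ Finset.HasAntidiagonal.antidiagonal n, (PowerSeries.coeff kl.1 p * z ^ kl.1) *
        (PowerSeries.coeff kl.2 q * z ^ kl.2) := by
    intro n
    rw [PowerSeries.coeff_mul, Finset.sum_mul]
    refine Finset.sum_congr rfl fun x hx => ?_
    rw [← Finset.HasAntidiagonal.mem_antidiagonal.1 hx, pow_add]; ring
  constructor
  · have h := summable_norm_sum_mul_antidiagonal_of_summable_norm hp.1 hq.1
    refine h.congr fun n => ?_
    rw [key n]
  · have h := tsum_mul_tsum_eq_tsum_sum_antidiagonal_of_summable_norm hp.1 hq.1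
    rw [hp.2, hq.2] at h
    rw [h]
    exact tsum_congr key

lemma Ev.add {p q : PowerSeries ℂ} {z v w : ℂ} (hp : Ev p z v) (hq : Ev q z w) :
    Ev (p + q) z (v + w) := by
  constructor
  · simp_rw [map_add, add_mul]
    exact Summable.of_nonneg_of_le (fun _ => norm_nonneg _) (fun _ => norm_add_le _ _)
      (hp.1.add hq.1)
  · simp_rw [map_add, add_mul]
    rw [hp.1.of_norm.tsum_add hq.1.of_norm, hp.2, hq.2]

lemma Ev.poly (p : ℂ[X]) (z : ℂ) : Ev (p : PowerSeries ℂ) z (p.eval z) := by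
  have hz : ∀ n ∉ Finset.range (p.natDegree + 1),
      PowerSeries.coeff n (p : PowerSeries ℂ) * z ^ n = 0 := by
    intro n hn
    rw [Polynomial.coeff_coe, coeff_eq_zero_of_natDegree_lt (by simpa using hn), zero_mul]
  constructor
  · refine summable_of_ne_finset_zero (s := Finset.range (p.natDegree + 1)) fun n hn => ?_
    rw [hz n hn, norm_zero]
  · rw [tsum_eq_sum hz, eval_eq_sum_range]
    simp

lemma Ev.pow {p : PowerSeries ℂ} {z v : ℂ} (hp : Ev p z v) (n : ℕ) : Ev (p ^ n) z (v ^ n) := by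
  induction n with
  | zero => simpa using Ev.poly 1 z
  | succ n ih => rw [pow_succ, pow_succ]; exact ih.mul hp

lemma Ev.sum {ι : Type*} (s : Finset ι) (p : ι → PowerSeries ℂ) (v : ι → ℂ) {z : ℂ}
    (h : ∀ i ∈ s, Ev (p i) z (v i)) : Ev (∑ i ∈ s, p i) z (∑ i ∈ s, v i) := by
  classical
  induction s using Finset.induction_on with
  | empty => simpa using Ev.poly 0 z
  | insert a s ha ih =>
    rw [Finset.sum_insert ha, Finset.sum_insert ha]
    exact (h a (Finset.mem_insert_self _ _)).add
      (ih fun i hi => h i (Finset.mem_insert_of_mem hi))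

lemma Ev.expand {p : PowerSeries ℂ} {z v : ℂ} {m : ℕ} (hm : m ≠ 0) (hp : Ev p (z ^ m) v) :
    Ev (PowerSeries.expand m hm p) z v := by
  have hinj : Function.Injective (fun n : ℕ => m * n) := fun a b h =>
    Nat.eq_of_mul_eq_mul_left (Nat.pos_of_ne_zero hm) h
  have hsupp : ∀ x ∉ Set.range (fun n : ℕ => m * n),
      PowerSeries.coeff x (PowerSeries.expand m hm p) * z ^ x = 0 := by
    intro x hx
    rw [PowerSeries.coeff_expand_of_not_dvd, zero_mul]
    rintro ⟨c, rfl⟩; exact hx ⟨c, rfl⟩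
  have hc : ∀ n, PowerSeries.coeff (m * n) (PowerSeries.expand m hm p) * z ^ (m * n) =
      PowerSeries.coeff n p * (z ^ m) ^ n := by
    intro n; rw [PowerSeries.coeff_expand_mul, pow_mul]
  constructor
  · rw [← hinj.summable_iff (fun x hx => by rw [hsupp x hx, norm_zero])]
    have := hp.1
    simpa only [Function.comp_def, hc] using this
  · rw [← hp.2, ← hinj.tsum_eq (f := fun n => PowerSeries.coeff n (PowerSeries.expand m hm p) * z ^ n)]
    · simp only [hc]
    · intro x hx
      by_contra h
      exact hx (hsupp x h)

lemma hS_ev (hT : 2 ≤ T) (he : 1 ≤ e)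
    (hQn : ∀ i, 0 ≤ Q.coeff i) (hQ0 : Q.coeff 0 = 1) (f0 : f 0 = 0) (f1 : f 1 = 1)
    (hf : ∀ n, f (n + 2) = Q * (f (n + 1)).comp (X ^ T) + X ^ (T * e) * (f n).comp (X ^ (T * T)))
    (H : ℂ → ℂ) (hH : ∀ z : ℂ, ‖z‖ < 1 →
      Filter.Tendsto (fun n => Polynomial.aeval z (f n)) Filter.atTop (nhds (H z)))
    (z : ℂ) (hz : ‖z‖ < 1) : Ev (PowerSeries.map (Int.castRingHom ℂ) (hS f)) z (H z) := by
  have hmono : ∀ i, Monotone fun n => (f n).coeff i := fun i =>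
    monotone_nat_of_le_succ fun n => by
      have := f_nonneg hT hQn hQ0 f0 f1 hf n i
      rw [coeff_sub] at this; linarith
  have hnn : ∀ n i, 0 ≤ (f n).coeff i := fun n i => by
    have := hmono i (Nat.zero_le n)
    simpa [f0] using this
  have hle : ∀ n i, (f n).coeff i ≤ (f (i + 1)).coeff i := fun n i => by
    rw [← f_stab hT he hQ0 f0 f1 hf i (max n (i + 1)) (by omega)]
    exact hmono i (le_max_left _ _)
  have heval : ∀ (w : ℂ) n, Ev ((f n).map (Int.castRingHom ℂ) : ℂ[X]) w (Polynomial.aeval w (f n)) := by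
    intro w n
    have := Ev.poly ((f n).map (Int.castRingHom ℂ)) w
    rwa [eval_map, ← algebraMap_int_eq, ← aeval_def] at this
  -- summability
  have hsum : Summable fun i => ((f (i + 1)).coeff i : ℝ) * ‖z‖ ^ i := by
    have hr : ‖((‖z‖ : ℝ) : ℂ)‖ < 1 := by simpa using hz
    obtain ⟨B, hB⟩ := (hH _ hr).norm.bddAbove_range
    refine summable_of_sum_range_le (c := B) (fun i => ?_) fun n => ?_
    · exact mul_nonneg (by exact_mod_cast hnn _ _) (by positivity)
    · have hb : ‖Polynomial.aeval ((‖z‖ : ℝ) : ℂ) (f n)‖ ≤ B := hB ⟨n, rfl⟩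
      have h1 : Polynomial.aeval ((‖z‖ : ℝ) : ℂ) (f n) = ((Polynomial.aeval (‖z‖ : ℝ) (f n) : ℝ) : ℂ) := by
        have := Polynomial.aeval_algebraMap_apply ℂ (‖z‖ : ℝ) (f n)
        simpa using this
      rw [h1, Complex.norm_real, Real.norm_eq_abs] at hb
      refine le_trans ?_ ((le_abs_self _).trans hb)
      rw [aeval_eq_sum_range' (n := max n ((f n).natDegree + 1)) (by omega)]
      refine le_trans (Finset.sum_le_sum (g := fun i => (f n).coeff i • ‖z‖ ^ i) fun i hi => ?_)
        (Finset.sum_le_sum_of_subset_of_nonneg (Finset.range_mono (le_max_left _ _)) fun i _ _ => ?_)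
      · rw [f_stab hT he hQ0 f0 f1 hf i n (Finset.mem_range.1 hi)]; simp
      · rw [zsmul_eq_mul]
        exact mul_nonneg (by exact_mod_cast hnn _ _) (by positivity)
  have hco : ∀ i, PowerSeries.coeff i (PowerSeries.map (Int.castRingHom ℂ) (hS f)) * z ^ i =
      ((f (i + 1)).coeff i : ℂ) * z ^ i := by
    intro i; simp [hS]
  have hnorm : ∀ n i, ‖((f n).coeff i : ℂ) * z ^ i‖ = ((f n).coeff i : ℝ) * ‖z‖ ^ i := by
    intro n i
    rw [norm_mul, norm_pow, Complex.norm_intCast, abs_of_nonneg (by exact_mod_cast hnn _ _)]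
  constructor
  · simp_rw [hco, hnorm]; exact hsum
  · refine tendsto_nhds_unique ?_ (hH z hz)
    have h2 : ∀ n, Polynomial.aeval z (f n) = ∑' i, ((f n).coeff i : ℂ) * z ^ i := by
      intro n
      rw [← (heval z n).2]; simp
    simp_rw [h2, hco]
    refine tendsto_tsum_of_dominated_convergence hsum (fun i => ?_) (Filter.Eventually.of_forall
      fun n i => ?_)
    · refine tendsto_const_nhds.congr' ?_
      filter_upwards [Filter.eventually_gt_atTop i] with n hn
      rw [f_stab hT he hQ0 f0 f1 hf i n hn]
    · rw [hnorm]
      gcongr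
      exact hle n i

end series

section functional

/-- the embedding of polynomials into power series -/
noncomputable abbrev iotaP : ℂ[X] →+* PowerSeries ℂ := Polynomial.coeToPowerSeries.ringHom

/-- the homogenised relation, evaluated -/
noncomputable def Rh (R : ℂ[X][X]) (d : ℕ) (z x y : ℂ) : ℂ :=
  ∑ j ∈ Finset.range (d + 1), (R.coeff j).eval z * x ^ j * y ^ (d - j)

/-- a primitive relation of minimal degree `d` for `G` -/
structure MinRel (G : PowerSeries ℂ) (R : ℂ[X][X]) (d : ℕ) : Prop where
  deg : R.natDegree = d
  ne : R ≠ 0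
  rel : R.eval₂ iotaP G = 0
  min : ∀ S : ℂ[X][X], S.eval₂ iotaP G = 0 → S.natDegree < d → S = 0
  prim : R.IsPrimitive

lemma exists_minRel (G : PowerSeries ℂ) (R₀ : ℂ[X][X]) (h0 : R₀ ≠ 0) (h1 : R₀.eval₂ iotaP G = 0) :
    ∃ R d, MinRel G R d := by
  classical
  have hex : ∃ d, ∃ R : ℂ[X][X], R ≠ 0 ∧ R.eval₂ iotaP G = 0 ∧ R.natDegree = d :=
    ⟨_, R₀, h0, h1, rfl⟩
  set d := Nat.find hex with hd
  have hex2 : ∃ m, ∃ R : ℂ[X][X], R ≠ 0 ∧ R.eval₂ iotaP G = 0 ∧ R.natDegree = d ∧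
      R.leadingCoeff.natDegree = m := by
    obtain ⟨R, a, b, c⟩ := Nat.find_spec hex
    exact ⟨_, R, a, b, c, rfl⟩
  obtain ⟨R, ha, hb, hc, hm⟩ := Nat.find_spec hex2
  refine ⟨R, d, hc, ha, hb, ?_, ?_⟩
  · intro S hS hlt
    by_contra hne
    exact Nat.find_min hex hlt ⟨S, hne, hS, rfl⟩
  · rintro r ⟨S, hS⟩
    have hr : r ≠ 0 := by rintro rfl; apply ha; rw [hS]; simp
    have hSne : S ≠ 0 := by rintro rfl; apply ha; rw [hS]; simp
    by_contra hu
    have hdeg : 0 < r.natDegree := by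
      rw [Nat.pos_iff_ne_zero]
      intro h
      apply hu
      rw [eq_C_of_natDegree_eq_zero h]
      refine isUnit_C.2 (Ne.isUnit ?_)
      intro h2
      apply hr
      rw [eq_C_of_natDegree_eq_zero h, h2, C_0]
    have hSdeg : S.natDegree = d := by
      rw [← hc, hS, natDegree_C_mul hr]
    have hrel : S.eval₂ iotaP G = 0 := by
      rw [hS, eval₂_mul, eval₂_C] at hb
      rcases mul_eq_zero.1 hb with h | h
      · exact absurd ((Polynomial.coe_eq_zero_iff (φ := r)).1 h) hr
      · exact h
    refine Nat.find_min hex2 (m := S.leadingCoeff.natDegree) ?_ ⟨S, hSne, hrel, hSdeg, rfl⟩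
    rw [← hm, hS, leadingCoeff_mul, leadingCoeff_C, natDegree_mul hr (leadingCoeff_ne_zero.2 hSne)]
    omega

lemma Rh_one {R : ℂ[X][X]} {d : ℕ} (hd : R.natDegree = d) (z x : ℂ) :
    Rh R d z x 1 = (R.map (evalRingHom z)).eval x := by
  rw [Rh, eval_map, eval₂_eq_sum_range, hd]
  simp

lemma Rh_scale (R : ℂ[X][X]) (d : ℕ) (z x y s : ℂ) :
    Rh R d z (s * x) (s * y) = s ^ d * Rh R d z x y := by
  rw [Rh, Rh, Finset.mul_sum]
  refine Finset.sum_congr rfl fun j hj => ?_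
  have : s ^ d = s ^ j * s ^ (d - j) := by
    rw [← pow_add, Nat.add_sub_cancel' (by simpa [Nat.lt_succ_iff] using hj)]
  rw [this, mul_pow, mul_pow]; ring

lemma Rh_cont (R : ℂ[X][X]) (d : ℕ) (z : ℂ) : Continuous fun p : ℂ × ℂ => Rh R d z p.1 p.2 := by
  unfold Rh
  fun_prop

lemma MinRel.exists_ne {G R d} (h : MinRel G R d) (z : ℂ) (hz : ∀ x : ℂ, x ≠ 0 → Rh R d z x 1 = 0) :
    False := by
  have h0 : R.map (evalRingHom z) = 0 := by
    apply eq_zero_of_infinite_isRoot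
    refine Set.Infinite.mono ?_ (Set.finite_singleton (0 : ℂ)).infinite_compl
    intro x hx
    have := hz x hx
    rwa [Rh_one h.deg] at this
  have hdvd : C (X - C z) ∣ R := by
    rw [C_dvd_iff_dvd_coeff]
    intro i
    rw [dvd_iff_isRoot]
    have := congrArg (fun p => p.coeff i) h0
    simpa [coeff_map] using this
  exact not_isUnit_X_sub_C z (h.prim _ hdvd)

variable {T e : ℕ} {Q : ℂ[X]} {G : PowerSeries ℂ} {R : ℂ[X][X]} {d : ℕ}

/-- transformed relation -/
noncomputable def Rt (T e : ℕ) (Q : ℂ[X]) (R : ℂ[X][X]) (d : ℕ) : ℂ[X][X] :=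
  ∑ j ∈ Finset.range (d + 1), C ((R.coeff j).comp (X ^ T) * X ^ (T * e * j)) * (X - C Q) ^ (d - j)

lemma Rt_rel (hT : T ≠ 0) (hG : (G - (Q : PowerSeries ℂ)) * PowerSeries.expand T hT G =
    PowerSeries.X ^ (T * e)) (h : MinRel G R d) : (Rt T e Q R d).eval₂ iotaP G = 0 := by
  have h1 := congrArg (PowerSeries.expand T hT) h.rel
  rw [eval₂_eq_sum_range, h.deg, map_sum, map_zero] at h1
  rw [Rt, eval₂_finsetSum, ← mul_zero ((G - (Q : PowerSeries ℂ)) ^ d), ← h1, Finset.mul_sum]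
  refine Finset.sum_congr rfl fun j hj => ?_
  have hs : (G - (Q : PowerSeries ℂ)) ^ d = (G - (Q : PowerSeries ℂ)) ^ j *
      (G - (Q : PowerSeries ℂ)) ^ (d - j) := by
    rw [← pow_add, Nat.add_sub_cancel' (by simpa [Nat.lt_succ_iff] using hj)]
  have hx : (PowerSeries.X : PowerSeries ℂ) ^ (T * e * j) =
      (G - (Q : PowerSeries ℂ)) ^ j * (PowerSeries.expand T hT G) ^ j := by
    rw [pow_mul, ← hG, mul_pow]
  rw [map_mul (PowerSeries.expand T hT), map_pow (PowerSeries.expand T hT), eval₂_mul, eval₂_C,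
    eval₂_pow, eval₂_sub, eval₂_X, eval₂_C, map_mul iotaP]
  have h2 : (PowerSeries.expand T hT) (iotaP (R.coeff j)) = iotaP ((R.coeff j).comp (X ^ T)) :=
    expand_coe _ _ _
  have h3 : iotaP (X ^ (T * e * j)) = (PowerSeries.X : PowerSeries ℂ) ^ (T * e * j) := by simp
  have h4 : iotaP Q = (Q : PowerSeries ℂ) := rfl
  rw [h2, h3, h4, hs, hx]; ring

lemma Rt_deg : (Rt T e Q R d).natDegree ≤ d := by
  refine natDegree_sum_le_of_forall_le _ _ fun j hj => ?_
  refine natDegree_mul_le.trans ?_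
  rw [natDegree_C, zero_add, natDegree_pow, natDegree_X_sub_C]
  omega

lemma Rt_coeff : (Rt T e Q R d).coeff d = (R.coeff 0).comp (X ^ T) := by
  rw [Rt, finsetSum_coeff, Finset.sum_eq_single 0]
  · have hm := ((monic_X_sub_C Q).pow d).coeff_natDegree
    rw [natDegree_pow, natDegree_X_sub_C, mul_one] at hm
    rw [coeff_C_mul, Nat.sub_zero, hm]; simp
  · intro j hj hj0
    rw [coeff_C_mul, coeff_eq_zero_of_natDegree_lt (p := (X - C Q) ^ (d - j)), mul_zero]
    rw [natDegree_pow, natDegree_X_sub_C]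
    have := Finset.mem_range.1 hj
    omega
  · simp

lemma Rt_eval (z x : ℂ) : ((Rt T e Q R d).map (evalRingHom z)).eval x =
    Rh R d (z ^ T) (z ^ (T * e)) (x - Q.eval z) := by
  rw [Rt, Rh, Polynomial.map_sum, eval_finsetSum]
  refine Finset.sum_congr rfl fun j hj => ?_
  simp [eval_comp, pow_mul]

lemma G_ne (h : PowerSeries.constantCoeff G = 1) : G ≠ 0 := by
  rintro rfl; simp at h

lemma MinRel.pos (h : MinRel G R d) : 1 ≤ d := by
  rw [Nat.one_le_iff_ne_zero]
  intro hd
  have h1 := h.deg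
  rw [hd] at h1
  have h2 := h.rel
  rw [eq_C_of_natDegree_eq_zero h1, eval₂_C] at h2
  apply h.ne
  rw [eq_C_of_natDegree_eq_zero h1, (Polynomial.coe_eq_zero_iff (φ := R.coeff 0)).1 h2, C_0]

lemma MinRel.coeff_zero (hG1 : PowerSeries.constantCoeff G = 1) (h : MinRel G R d) :
    R.coeff 0 ≠ 0 := by
  intro h0
  obtain ⟨S, hS⟩ := X_dvd_iff.2 h0
  have hSne : S ≠ 0 := by rintro rfl; apply h.ne; rw [hS]; simp
  have h2 := h.rel
  rw [hS, eval₂_mul, eval₂_X] at h2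
  have h3 := h.deg
  rw [hS, natDegree_X_mul hSne] at h3
  exact hSne (h.min S ((mul_eq_zero.1 h2).resolve_left (G_ne hG1)) (by omega))

lemma Rt_prop (hT : T ≠ 0) (hG : (G - (Q : PowerSeries ℂ)) * PowerSeries.expand T hT G =
    PowerSeries.X ^ (T * e)) (h : MinRel G R d) :
    C (R.coeff d) * Rt T e Q R d = C ((R.coeff 0).comp (X ^ T)) * R := by
  rw [← sub_eq_zero]
  refine h.min _ ?_ ?_
  · rw [eval₂_sub, eval₂_mul, eval₂_mul, Rt_rel hT hG h, h.rel]; simp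
  · have hp := h.pos
    have hle : (C (R.coeff d) * Rt T e Q R d - C ((R.coeff 0).comp (X ^ T)) * R).natDegree ≤ d := by
      refine (natDegree_sub_le _ _).trans (max_le ?_ ?_)
      · exact (natDegree_C_mul_le _ _).trans Rt_deg
      · exact (natDegree_C_mul_le _ _).trans h.deg.le
    refine lt_of_le_of_ne hle fun heq => ?_
    have hc : (C (R.coeff d) * Rt T e Q R d - C ((R.coeff 0).comp (X ^ T)) * R).coeff d = 0 := by
      rw [coeff_sub, coeff_C_mul, coeff_C_mul, Rt_coeff]; ring
    have h0 : C (R.coeff d) * Rt T e Q R d - C ((R.coeff 0).comp (X ^ T)) * R = 0 := by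
      rw [← leadingCoeff_eq_zero, leadingCoeff, heq, hc]
    rw [h0, natDegree_zero] at heq
    omega

lemma comp_X_pow_ne {p : ℂ[X]} (hT : T ≠ 0) (hp : p ≠ 0) : p.comp (X ^ T) ≠ 0 := by
  rw [← expand_eq_comp_X_pow]
  exact (expand_ne_zero (Nat.pos_of_ne_zero hT)).2 hp

lemma exists_coprime_fac (a b : ℂ[X]) (hb : b ≠ 0) :
    ∃ g A B : ℂ[X], g ≠ 0 ∧ a = g * A ∧ b = g * B ∧ IsCoprime A B := by
  have hg : EuclideanDomain.gcd a b ≠ 0 := by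
    intro h0
    exact hb (EuclideanDomain.gcd_eq_zero_iff.1 h0).2
  have hbez := EuclideanDomain.gcd_eq_gcd_ab a b
  obtain ⟨A, hA⟩ := EuclideanDomain.gcd_dvd_left a b
  obtain ⟨B, hB⟩ := EuclideanDomain.gcd_dvd_right a b
  generalize EuclideanDomain.gcdA a b = u at *
  generalize EuclideanDomain.gcdB a b = v at *
  generalize EuclideanDomain.gcd a b = g at *
  refine ⟨g, A, B, hg, hA, hB, u, v, ?_⟩
  apply mul_left_cancel₀ hg
  rw [mul_one]
  conv_rhs => rw [hbez, hA, hB]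
  ring

lemma Rh_cont' (z : ℂ) (u v : ℂ → ℂ) (hu : Continuous u) (hv : Continuous v) :
    Continuous fun y => Rh R d z (u y) (v y) := by
  unfold Rh
  fun_prop

lemma Rh_ext {z w q a x c : ℂ} (key : ∀ y, y ≠ 0 → Rh R d w (a * y) (x - q * y) =
      c * Rh R d z x y) (y : ℂ) : Rh R d w (a * y) (x - q * y) = c * Rh R d z x y := by
  have h1 : Continuous fun y => Rh R d w (a * y) (x - q * y) :=
    Rh_cont' w _ _ (by fun_prop) (by fun_prop)
  have h2 : Continuous fun y => c * Rh R d z x y :=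
    continuous_const.mul (Rh_cont' z _ _ (by fun_prop) (by fun_prop))
  exact congrFun (Continuous.ext_on (dense_compl_singleton (0 : ℂ)) h1 h2 fun y hy => key y hy) y

lemma Rh_trans (hT : T ≠ 0) (hG : (G - (Q : PowerSeries ℂ)) * PowerSeries.expand T hT G =
    PowerSeries.X ^ (T * e)) (hG1 : PowerSeries.constantCoeff G = 1) (h : MinRel G R d)
    (z : ℂ) (hz : z ≠ 0) : ∃ c : ℂ, c ≠ 0 ∧ ∀ x y,
      Rh R d (z ^ T) (z ^ (T * e) * y) (x - Q.eval z * y) = c * Rh R d z x y := by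
  have hprop := Rt_prop hT hG h
  set a := R.coeff d with ha
  set b := (R.coeff 0).comp (X ^ T) with hb
  have hbne : b ≠ 0 := comp_X_pow_ne hT (h.coeff_zero hG1)
  obtain ⟨g, A, B, hg, hA, hB, hcop⟩ := exists_coprime_fac a b hbne
  have hAB : C A * Rt T e Q R d = C B * R := by
    have hg' : C g ≠ (0 : ℂ[X][X]) := C_ne_zero.2 hg
    apply mul_left_cancel₀ hg'
    rw [← mul_assoc, ← C_mul, ← hA, ← mul_assoc, ← C_mul, ← hB, hprop]
  have hev : ∀ x, A.eval z * Rh R d (z ^ T) (z ^ (T * e)) (x - Q.eval z) =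
      B.eval z * Rh R d z x 1 := by
    intro x
    have := congrArg (fun p => (p.map (evalRingHom z)).eval x) hAB
    simp only [Polynomial.map_mul, eval_mul, map_C, eval_C, coe_evalRingHom, Rt_eval] at this
    rw [this, Rh_one h.deg]
  obtain ⟨u, v, huv⟩ := hcop
  have huv' : u.eval z * A.eval z + v.eval z * B.eval z = 1 := by
    have := congrArg (eval z) huv; simpa using this
  have hAz : A.eval z ≠ 0 := by
    intro h0
    have hBz : B.eval z ≠ 0 := by rintro h1; rw [h0, h1] at huv'; simp at huv'
    refine h.exists_ne z fun x _ => ?_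
    have := hev x
    rw [h0, zero_mul] at this
    exact (mul_eq_zero.1 this.symm).resolve_left hBz
  have hBz : B.eval z ≠ 0 := by
    intro h0
    refine h.exists_ne (z ^ T) fun x hx => ?_
    have h1 := hev (z ^ (T * e) / x + Q.eval z)
    rw [h0, zero_mul, add_sub_cancel_right] at h1
    have h2 := (mul_eq_zero.1 h1).resolve_left hAz
    have h3 := Rh_scale R d (z ^ T) x 1 (z ^ (T * e) / x)
    rw [div_mul_cancel₀ _ hx, mul_one, h2] at h3
    exact (mul_eq_zero.1 h3.symm).resolve_left (pow_ne_zero _ (div_ne_zero (pow_ne_zero _ hz) hx))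
  refine ⟨B.eval z / A.eval z, div_ne_zero hBz hAz, fun x => ?_⟩
  have key : ∀ y, y ≠ 0 → Rh R d (z ^ T) (z ^ (T * e) * y) (x - Q.eval z * y) =
      B.eval z / A.eval z * Rh R d z x y := by
    intro y hy
    have h1 := hev (x / y)
    have h2 := Rh_scale R d (z ^ T) (z ^ (T * e)) (x / y - Q.eval z) y
    have h3 := Rh_scale R d z (x / y) 1 y
    rw [show y * z ^ (T * e) = z ^ (T * e) * y by ring,
      show y * (x / y - Q.eval z) = x - Q.eval z * y by field_simp] at h2
    rw [mul_one, mul_div_cancel₀ _ hy] at h3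
    rw [h2, h3]
    rw [div_mul_eq_mul_div, eq_div_iff hAz]
    linear_combination y ^ d * h1
  intro y
  exact Rh_ext key y


/-- the homogeneous form at `z` is a product of two powers of linear forms -/
def PP (R : ℂ[X][X]) (d i : ℕ) (z : ℂ) : Prop :=
  ∃ s a b a' b' : ℂ, ∀ x y, Rh R d z x y = s * (a * x + b * y) ^ i * (a' * x + b' * y) ^ (d - i)

lemma PP_back (hT : T ≠ 0) (hG : (G - (Q : PowerSeries ℂ)) * PowerSeries.expand T hT G =
    PowerSeries.X ^ (T * e)) (hG1 : PowerSeries.constantCoeff G = 1) (h : MinRel G R d)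
    {z : ℂ} (hz : z ≠ 0) {i : ℕ} (hP : PP R d i (z ^ T)) : PP R d i z := by
  obtain ⟨c, hc, hcR⟩ := Rh_trans hT hG hG1 h z hz
  obtain ⟨s, a, b, a', b', hs⟩ := hP
  refine ⟨s / c, b, a * z ^ (T * e) - b * Q.eval z, b', a' * z ^ (T * e) - b' * Q.eval z, ?_⟩
  intro x y
  have h1 := hcR x y
  rw [hs] at h1
  rw [div_mul_eq_mul_div, div_mul_eq_mul_div, eq_div_iff hc, mul_comm, ← h1]
  ring

lemma PP_back_iter (hT : T ≠ 0) (hG : (G - (Q : PowerSeries ℂ)) * PowerSeries.expand T hT G =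
    PowerSeries.X ^ (T * e)) (hG1 : PowerSeries.constantCoeff G = 1) (h : MinRel G R d)
    {z : ℂ} (hz : z ≠ 0) {i : ℕ} (hP : PP R d i z) (n : ℕ) :
    ∀ w : ℂ, w ^ T ^ n = z → PP R d i w := by
  induction n with
  | zero => intro w hw; simp at hw; rwa [hw]
  | succ n ih =>
    intro w hw
    have hw0 : w ≠ 0 := by
      rintro rfl
      rw [zero_pow (pow_ne_zero _ hT)] at hw
      exact hz hw.symm
    refine PP_back hT hG hG1 h hw0 (ih _ ?_)
    rw [← pow_mul, ← hw, pow_succ, mul_comm]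

lemma no_poly (hT : 2 ≤ T) (D : ℂ[X]) (hD : D ≠ 0) (z : ℂ) (hz : z ≠ 0)
    (h : ∀ n w, w ^ T ^ n = z → D.eval w = 0) : False := by
  set n := D.natDegree
  have hlt : n < T ^ n := Nat.lt_pow_self (by omega)
  have hsub : (nthRoots (T ^ n) z).toFinset ⊆ D.roots.toFinset := by
    intro w hw
    rw [Multiset.mem_toFinset, mem_nthRoots (by omega)] at hw
    rw [Multiset.mem_toFinset, mem_roots hD]
    exact h n w hw
  have hcard : (nthRoots (T ^ n) z).toFinset.card = T ^ n := by
    have hsep : (X ^ (T ^ n) - C z : ℂ[X]).Separable := by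
      refine separable_X_pow_sub_C z ?_ hz
      exact_mod_cast (by omega : T ^ n ≠ 0)
    have hnd : (nthRoots (T ^ n) z).Nodup := nodup_roots hsep
    rw [Multiset.toFinset_card_of_nodup hnd, nthRoots,
      (splits_iff_card_roots.1 (IsAlgClosed.splits _)), natDegree_X_pow_sub_C]
  have h1 := Finset.card_le_card hsub
  have h2 := Multiset.toFinset_card_le D.roots
  have h3 := card_roots' D
  omega

lemma PP_at_one {k : ℕ} (hk : 1 ≤ k) (c : ℂ)
    (hc : ∀ x y, Rh R d 1 y (x - k * y) = c * Rh R d 1 x y) : ∃ i ≤ d, PP R d i 1 := by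
  obtain ⟨r₁, r₂, q, h1, h2, hne, h20, hq, hq0, hq1⟩ : ∃ r₁ r₂ q : ℂ, r₁ ^ 2 = 1 - k * r₁ ∧
      r₂ ^ 2 = 1 - k * r₂ ∧ r₁ - r₂ ≠ 0 ∧ r₂ ≠ 0 ∧ q * r₂ = r₁ ∧ q ≠ 0 ∧ ‖q‖ < 1 := by
    set s := √((k : ℝ) ^ 2 + 4) with hs
    have hk' : (1 : ℝ) ≤ k := by exact_mod_cast hk
    have hs2 : s ^ 2 = (k : ℝ) ^ 2 + 4 := Real.sq_sqrt (by positivity)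
    have hs0 : 0 ≤ s := Real.sqrt_nonneg _
    have hsk : (k : ℝ) < s := by nlinarith
    have e2 : (-(k : ℝ) - s) / 2 ≠ 0 := by
      intro h; nlinarith
    have hq : ((-(k : ℝ) + s) / 2) / ((-(k : ℝ) - s) / 2) ≠ 0 := by
      refine div_ne_zero ?_ e2
      intro h; nlinarith
    refine ⟨(((-(k : ℝ) + s) / 2 : ℝ) : ℂ), (((-(k : ℝ) - s) / 2 : ℝ) : ℂ),
      ((((-(k : ℝ) + s) / 2) / ((-(k : ℝ) - s) / 2) : ℝ) : ℂ), ?_, ?_, ?_, ?_, ?_, ?_, ?_⟩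
    · have : ((-(k : ℝ) + s) / 2) ^ 2 = 1 - k * ((-(k : ℝ) + s) / 2) := by nlinarith
      exact_mod_cast this
    · have : ((-(k : ℝ) - s) / 2) ^ 2 = 1 - k * ((-(k : ℝ) - s) / 2) := by nlinarith
      exact_mod_cast this
    · have : ((-(k : ℝ) + s) / 2) - ((-(k : ℝ) - s) / 2) ≠ 0 := by intro h; nlinarith
      exact_mod_cast this
    · exact_mod_cast e2
    · have := div_mul_cancel₀ ((-(k : ℝ) + s) / 2) e2
      exact_mod_cast this
    · exact_mod_cast hq
    · rw [Complex.norm_real, Real.norm_eq_abs, abs_div, div_lt_one (abs_pos.2 e2), abs_lt]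
      have : |(-(k : ℝ) - s) / 2| = ((k : ℝ) + s) / 2 := by
        rw [abs_of_neg (by linarith)]; ring
      rw [this]
      constructor <;> linarith
  have hg : ∀ u v, Rh R d 1 (r₁ * u + r₂ * v) (r₁ * (r₁ * u) + r₂ * (r₂ * v)) =
      c * Rh R d 1 (u + v) (r₁ * u + r₂ * v) := by
    intro u v
    rw [← hc]
    congr 1
    linear_combination u * h1 + v * h2
  set p : ℂ[X] := ∑ j ∈ Finset.range (d + 1), C ((R.coeff j).eval 1) * (X + C 1) ^ j *
    (C r₁ * X + C r₂) ^ (d - j) with hp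
  have hpe : ∀ u, p.eval u = Rh R d 1 (u + 1) (r₁ * u + r₂) := by
    intro u
    rw [hp, eval_finsetSum, Rh]
    simp
  have hpd : p.natDegree ≤ d := by
    refine natDegree_sum_le_of_forall_le _ _ fun j hj => ?_
    have hj' : j ≤ d := by simpa [Nat.lt_succ_iff] using hj
    refine natDegree_mul_le.trans ?_
    have e1 : (C ((R.coeff j).eval 1) * (X + C 1 : ℂ[X]) ^ j).natDegree ≤ j := by
      refine (natDegree_C_mul_le _ _).trans (natDegree_pow_le.trans ?_)
      rw [natDegree_X_add_C, mul_one]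
    have e2 : ((C r₁ * X + C r₂ : ℂ[X]) ^ (d - j)).natDegree ≤ d - j := by
      refine natDegree_pow_le.trans ?_
      have := natDegree_linear_le (a := r₁) (b := r₂)
      nlinarith
    omega
  have hcomp : C (r₂ ^ d) * p.comp (C q * X) = C c * p := by
    refine Polynomial.funext fun u => ?_
    rw [eval_mul, eval_comp, eval_mul, eval_C, eval_C, eval_mul, eval_C, eval_X, hpe, hpe,
      ← Rh_scale]
    have := hg u 1
    rw [mul_one] at this
    rw [← this, ← hq]
    congr 1 <;> ring
  have hcoef : ∀ i, r₂ ^ d * q ^ i * p.coeff i = c * p.coeff i := by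
    intro i
    have := congrArg (fun r => r.coeff i) hcomp
    simp only [coeff_C_mul, comp_C_mul_X_coeff] at this
    rw [← this]; ring
  have hinj : ∀ i j, q ^ i = q ^ j → i = j := by
    intro i j hij
    have := congrArg norm hij
    rw [norm_pow, norm_pow] at this
    exact (pow_right_injective₀ (norm_pos_iff.2 hq0) hq1.ne) this
  obtain ⟨i, hid, s, hmon⟩ : ∃ i ≤ d, ∃ s, p = C s * X ^ i := by
    by_cases hp0 : p = 0
    · exact ⟨0, Nat.zero_le _, 0, by simp [hp0]⟩
    refine ⟨p.natDegree, hpd, p.leadingCoeff, ?_⟩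
    ext j
    rw [coeff_C_mul_X_pow]
    split_ifs with hj
    · rw [hj]; rfl
    · by_contra hne
      apply hj
      apply hinj
      have a1 := mul_right_cancel₀ hne (hcoef j)
      have a2 := mul_right_cancel₀ (leadingCoeff_ne_zero.2 hp0) (hcoef p.natDegree)
      exact mul_left_cancel₀ (pow_ne_zero d h20) (a1.trans a2.symm)
  have hR0 : ∀ u v, v ≠ 0 → Rh R d 1 (u + v) (r₁ * u + r₂ * v) = s * u ^ i * v ^ (d - i) := by
    intro u v hv
    have e1 := hpe (u / v)
    have e2 := Rh_scale R d 1 (u / v + 1) (r₁ * (u / v) + r₂) v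
    rw [← e1, hmon, show v * (u / v + 1) = u + v by field_simp,
      show v * (r₁ * (u / v) + r₂) = r₁ * u + r₂ * v by field_simp] at e2
    rw [e2, eval_mul, eval_C, eval_pow, eval_X, div_pow,
      show v ^ d = v ^ i * v ^ (d - i) by rw [← pow_add, Nat.add_sub_cancel' hid]]
    field_simp
  have hR : ∀ u v, Rh R d 1 (u + v) (r₁ * u + r₂ * v) = s * u ^ i * v ^ (d - i) := by
    intro u v
    have c1 : Continuous fun v => Rh R d 1 (u + v) (r₁ * u + r₂ * v) :=
      Rh_cont' 1 _ _ (by fun_prop) (by fun_prop)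
    have c2 : Continuous fun v : ℂ => s * u ^ i * v ^ (d - i) := by fun_prop
    exact congrFun (Continuous.ext_on (dense_compl_singleton (0 : ℂ)) c1 c2
      fun v hv => hR0 u v hv) v
  refine ⟨i, hid, s, -r₂ / (r₁ - r₂), 1 / (r₁ - r₂), r₁ / (r₁ - r₂), -1 / (r₁ - r₂), ?_⟩
  intro x y
  rw [← hR]
  congr 1 <;> field_simp <;> ring

lemma MinRel.irr (h : MinRel G R d) : Irreducible R := by
  have key : ∀ a b : ℂ[X][X], R = a * b → a.eval₂ iotaP G = 0 → IsUnit b := by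
    intro a b hab ha
    have ha0 : a ≠ 0 := by rintro rfl; apply h.ne; rw [hab, zero_mul]
    have hb0 : b ≠ 0 := by rintro rfl; apply h.ne; rw [hab, mul_zero]
    have h1 : d ≤ a.natDegree := by
      by_contra hlt
      exact ha0 (h.min a ha (by omega))
    have h2 := h.deg
    rw [hab, natDegree_mul ha0 hb0] at h2
    have hb : b = C (b.coeff 0) := eq_C_of_natDegree_eq_zero (by omega)
    rw [hb]
    refine isUnit_C.2 (h.prim _ ?_)
    rw [← hb, hab]
    exact dvd_mul_left _ _
  refine ⟨?_, ?_⟩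
  · intro hu
    have := natDegree_eq_zero_of_isUnit hu
    have h1 := h.pos
    rw [h.deg] at this
    omega
  · intro a b hab
    have h1 := h.rel
    rw [hab, eval₂_mul] at h1
    rcases mul_eq_zero.1 h1 with h2 | h2
    · exact Or.inr (key a b hab h2)
    · exact Or.inl (key b a (by rw [hab, mul_comm]) h2)

lemma MinRel.bezout (h : MinRel G R d) : ∃ (U V : ℂ[X][X]) (D : ℂ[X]), D ≠ 0 ∧
    U * R + V * derivative R = C D := by
  have hirr := (IsPrimitive.irreducible_iff_irreducible_map_fraction_map
    (K := FractionRing ℂ[X]) h.prim).1 h.irr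
  obtain ⟨u, v, huv⟩ := hirr.separable
  obtain ⟨b₁, hm₁, hb₁⟩ := IsLocalization.integerNormalization_spec (nonZeroDivisors ℂ[X]) u
  obtain ⟨b₂, hm₂, hb₂⟩ := IsLocalization.integerNormalization_spec (nonZeroDivisors ℂ[X]) v
  set U := IsLocalization.integerNormalization (nonZeroDivisors ℂ[X]) u
  set V := IsLocalization.integerNormalization (nonZeroDivisors ℂ[X]) v
  refine ⟨C (b₂ : ℂ[X]) * U, C (b₁ : ℂ[X]) * V, b₁ * b₂,
    mul_ne_zero (nonZeroDivisors.ne_zero hm₁) (nonZeroDivisors.ne_zero hm₂), ?_⟩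
  have hinj : Function.Injective (Polynomial.map (algebraMap ℂ[X] (FractionRing ℂ[X]))) :=
    map_injective _ (IsFractionRing.injective _ _)
  apply hinj
  rw [derivative_map] at huv
  simp only [Polynomial.map_add, Polynomial.map_mul, map_C, hb₁, hb₂, map_mul]
  rw [← algebraMap_smul (FractionRing ℂ[X]) (b₁ : ℂ[X]) u,
    ← algebraMap_smul (FractionRing ℂ[X]) (b₂ : ℂ[X]) v, smul_eq_C_mul, smul_eq_C_mul]
  linear_combination C (algebraMap ℂ[X] (FractionRing ℂ[X]) b₁) *
    C (algebraMap ℂ[X] (FractionRing ℂ[X]) b₂) * huv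

lemma double_root {f : ℂ[X]} {i j : ℕ} (hi : 2 ≤ i) (hf : f.natDegree = i + j) {s a b a' b' : ℂ}
    (h : f = C s * (C a * X + C b) ^ i * (C a' * X + C b') ^ j) :
    ∃ x, f.eval x = 0 ∧ (derivative f).eval x = 0 := by
  have ha : a ≠ 0 := by
    rintro rfl
    have h1 : f.natDegree ≤ 0 + j := by
      rw [h]
      refine natDegree_mul_le.trans (add_le_add ?_ ?_)
      · have : C s * (C 0 * X + C b : ℂ[X]) ^ i = C (s * b ^ i) := by simp
        rw [this, natDegree_C]
      · refine natDegree_pow_le.trans ?_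
        have := natDegree_linear_le (a := a') (b := b')
        nlinarith
    omega
  have h2 : f = (C a * X + C b) ^ 2 *
      (C s * (C a * X + C b) ^ (i - 2) * (C a' * X + C b') ^ j) := by
    have : (C a * X + C b : ℂ[X]) ^ i = (C a * X + C b) ^ 2 * (C a * X + C b) ^ (i - 2) := by
      rw [← pow_add, Nat.add_sub_cancel' hi]
    rw [h, this]; ring
  generalize (C s * (C a * X + C b) ^ (i - 2) * (C a' * X + C b') ^ j) = g at h2
  have h0 : a * (-b / a) + b = 0 := by field_simp; ring
  refine ⟨-b / a, ?_, ?_⟩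
  · rw [h2]; simp [h0]
  · rw [h2]; simp [h0, derivative_pow]

lemma PP_double (h : MinRel G R d) (hd : 3 ≤ d) {i : ℕ} (hi : i ≤ d) {w : ℂ} (hP : PP R d i w)
    (hw : (R.coeff d).eval w ≠ 0) : ∃ x, (R.map (evalRingHom w)).eval x = 0 ∧
      (derivative (R.map (evalRingHom w))).eval x = 0 := by
  obtain ⟨s, a, b, a', b', hs⟩ := hP
  have hf : R.map (evalRingHom w) =
      C s * (C a * X + C b) ^ i * (C a' * X + C b') ^ (d - i) := by
    refine Polynomial.funext fun x => ?_
    rw [← Rh_one h.deg, hs]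
    simp
  have hdeg : (R.map (evalRingHom w)).natDegree = d := by
    rw [← h.deg]
    apply natDegree_map_of_leadingCoeff_ne_zero
    rw [leadingCoeff, h.deg]
    exact hw
  by_cases hi2 : 2 ≤ i
  · exact double_root (j := d - i) hi2 (by omega) hf
  · refine double_root (i := d - i) (j := i) (by omega) (by omega) (s := s) (a := a') (b := b')
      (a' := a) (b' := b) ?_
    rw [hf]; ring

lemma no_ge_three (hT2 : 2 ≤ T) (hT : T ≠ 0)
    (hG : (G - (Q : PowerSeries ℂ)) * PowerSeries.expand T hT G =
    PowerSeries.X ^ (T * e)) (hG1 : PowerSeries.constantCoeff G = 1) (h : MinRel G R d)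
    {k : ℕ} (hk : 1 ≤ k) (hQ1 : Q.eval 1 = k) (hd : 3 ≤ d) : False := by
  obtain ⟨c, -, hc⟩ := Rh_trans hT hG hG1 h 1 one_ne_zero
  simp only [one_pow, one_mul, hQ1] at hc
  obtain ⟨i, hi, hP⟩ := PP_at_one hk c hc
  obtain ⟨U, V, D, hD, hUV⟩ := h.bezout
  have hlc : R.coeff d ≠ 0 := by
    rw [← h.deg]; exact leadingCoeff_ne_zero.2 h.ne
  refine no_poly hT2 (R.coeff d * D) (mul_ne_zero hlc hD) 1 one_ne_zero fun n w hw => ?_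
  rw [eval_mul]
  by_cases hw0 : (R.coeff d).eval w = 0
  · rw [hw0, zero_mul]
  obtain ⟨x, hx1, hx2⟩ := PP_double h hd hi (PP_back_iter hT hG hG1 h one_ne_zero hP n w hw) hw0
  have := congrArg (fun p => (p.map (evalRingHom w)).eval x) hUV
  simp only [Polynomial.map_add, Polynomial.map_mul, eval_add, eval_mul, map_C, eval_C,
    coe_evalRingHom, hx1, ← derivative_map, hx2] at this
  rw [← this]; simp

lemma PP_two_iff {z : ℂ} : PP R 2 2 z ↔
    (R.coeff 1).eval z ^ 2 - 4 * (R.coeff 0).eval z * (R.coeff 2).eval z = 0 := by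
  have hR : ∀ x y, Rh R 2 z x y = (R.coeff 0).eval z * y ^ 2 + (R.coeff 1).eval z * x * y +
      (R.coeff 2).eval z * x ^ 2 := by
    intro x y; simp [Rh, Finset.sum_range_succ]
  constructor
  · rintro ⟨s, a, b, a', b', h⟩
    have e1 := h 1 0
    have e2 := h 0 1
    have e3 := h 1 1
    rw [hR] at e1 e2 e3
    simp at e1 e2 e3
    have e4 : (R.coeff 1).eval z = 2 * s * a * b := by linear_combination e3 - e1 - e2
    rw [e1, e2, e4]; ring
  · intro h
    by_cases h2 : (R.coeff 2).eval z = 0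
    · have h1 : (R.coeff 1).eval z = 0 := by
        rw [h2] at h; simpa using h
      refine ⟨(R.coeff 0).eval z, 0, 1, 0, 0, fun x y => ?_⟩
      rw [hR, h1, h2]; simp
    · refine ⟨(R.coeff 2).eval z, 1, (R.coeff 1).eval z / (2 * (R.coeff 2).eval z), 0, 0,
        fun x y => ?_⟩
      rw [hR]
      field_simp
      linear_combination - y ^ 2 * h

lemma monomial_of_roots (p : ℂ[X]) (hp : p ≠ 0) (h : ∀ z, z ≠ 0 → p.eval z ≠ 0) :
    ∃ c s, c ≠ 0 ∧ p = C c * X ^ s := by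
  obtain ⟨q, hq, hnd⟩ := exists_eq_pow_rootMultiplicity_mul_and_not_dvd p hp 0
  rw [C_0, sub_zero] at hq hnd
  have hroot : ∀ z, q.eval z ≠ 0 := by
    intro z hz
    by_cases hz0 : z = 0
    · apply hnd
      rw [hz0] at hz
      rw [X_dvd_iff, coeff_zero_eq_eval_zero, hz]
    · apply h z hz0
      rw [hq, eval_mul, hz, mul_zero]
  have hdeg : q.degree = 0 := by
    by_contra hne
    obtain ⟨z, hz⟩ := IsAlgClosed.exists_root q hne
    exact hroot z hz
  rw [eq_C_of_degree_eq_zero hdeg] at hq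
  refine ⟨q.coeff 0, _, ?_, by rw [mul_comm]; exact hq⟩
  intro h0
  apply hp
  rw [hq, h0]; simp

lemma no_two (hT2 : 2 ≤ T) (hT : T ≠ 0)
    (hG : (G - (Q : PowerSeries ℂ)) * PowerSeries.expand T hT G =
    PowerSeries.X ^ (T * e)) (hG1 : PowerSeries.constantCoeff G = 1) (h : MinRel G R 2) :
    False := by
  have hlc : R.coeff 2 ≠ 0 := by
    rw [← h.deg]; exact leadingCoeff_ne_zero.2 h.ne
  set r0 := R.coeff 0 with hr0
  set r1 := R.coeff 1 with hr1
  set r2 := R.coeff 2 with hr2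
  set W := 2 * (r2 : PowerSeries ℂ) * G + (r1 : PowerSeries ℂ) with hW
  have hrel : (r0 : PowerSeries ℂ) + (r1 : PowerSeries ℂ) * G + (r2 : PowerSeries ℂ) * G ^ 2 = 0 := by
    have := h.rel
    rw [eval₂_eq_sum_range, h.deg] at this
    simpa [Finset.sum_range_succ] using this
  set δ : ℂ[X] := r1 ^ 2 - 4 * r0 * r2 with hδ
  have h4 : ((4 : ℂ[X]) : PowerSeries ℂ) = 4 := map_ofNat (Polynomial.coeToPowerSeries.ringHom) 4
  have h2c : ((2 : ℂ[X]) : PowerSeries ℂ) = 2 := map_ofNat (Polynomial.coeToPowerSeries.ringHom) 2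
  have hW2 : W ^ 2 = (δ : PowerSeries ℂ) := by
    rw [hδ, hW, Polynomial.coe_sub, Polynomial.coe_mul, Polynomial.coe_mul, Polynomial.coe_pow, h4]
    linear_combination 4 * (r2 : PowerSeries ℂ) * hrel
  have hno : ∀ p : ℂ[X], W = (p : PowerSeries ℂ) → False := by
    intro p hp
    have h1 := h.min (C (2 * r2) * X + C (r1 - p)) ?_ ?_
    · have := congrArg (fun q => q.coeff 1) h1
      simp at this
      exact hlc this
    · rw [eval₂_add, eval₂_mul, eval₂_C, eval₂_C, eval₂_X]
      have e1 : iotaP (2 * r2) = 2 * (r2 : PowerSeries ℂ) := by simp [h2c]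
      have e2 : iotaP (r1 - p) = (r1 : PowerSeries ℂ) - (p : PowerSeries ℂ) := by simp
      rw [e1, e2, ← hp, hW]; ring
    · have := natDegree_linear_le (a := 2 * r2) (b := r1 - p)
      omega
  have hδ0 : δ ≠ 0 := by
    intro h0
    rw [h0, Polynomial.coe_zero] at hW2
    exact hno 0 (by rw [Polynomial.coe_zero]; exact pow_eq_zero_iff (two_ne_zero) |>.1 hW2)
  have hδe : ∀ z, δ.eval z = r1.eval z ^ 2 - 4 * r0.eval z * r2.eval z := by
    intro z; rw [hδ]; simp
  obtain ⟨c, s, hc, hcs⟩ := monomial_of_roots δ hδ0 (by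
    intro z hz hz0
    rw [hδe, ← PP_two_iff] at hz0
    refine no_poly hT2 δ hδ0 z hz fun n w hw => ?_
    rw [hδe, ← PP_two_iff]
    exact PP_back_iter hT hG hG1 h hz hz0 n w hw)
  have hW3 : W ^ 2 = PowerSeries.C c * PowerSeries.X ^ s := by
    rw [hW2, hcs]; simp
  have hW0 : W ≠ 0 := fun h0 => hno 0 (by rw [h0]; simp)
  obtain ⟨m, hm⟩ : ∃ m, s = m + m := by
    have ho := congrArg PowerSeries.order hW3
    have h0 : (PowerSeries.C c : PowerSeries ℂ).order = 0 := by
      rw [PowerSeries.order_zero_of_unit]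
      exact (Ne.isUnit hc).map PowerSeries.C
    rw [pow_two, PowerSeries.order_mul, PowerSeries.order_mul, h0, zero_add,
      PowerSeries.order_X_pow] at ho
    obtain ⟨m, hm⟩ := ENat.ne_top_iff_exists.1 (mt PowerSeries.order_eq_top.1 hW0)
    rw [← hm] at ho
    exact ⟨m, by exact_mod_cast ho.symm⟩
  obtain ⟨r, hr⟩ := IsAlgClosed.exists_pow_nat_eq c (n := 2) (by norm_num)
  have hsq : W ^ 2 = ((C r * X ^ m : ℂ[X]) : PowerSeries ℂ) ^ 2 := by
    rw [hW3, hm, ← hr]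
    simp
    ring
  rcases sq_eq_sq_iff_eq_or_eq_neg.1 hsq with h1 | h1
  · exact hno _ h1
  · exact hno (-(C r * X ^ m)) (by rw [h1, Polynomial.coe_neg])

lemma no_one (hT2 : 2 ≤ T) (he : 1 ≤ e) (hT : T ≠ 0)
    (hG : (G - (Q : PowerSeries ℂ)) * PowerSeries.expand T hT G =
    PowerSeries.X ^ (T * e)) (hG1 : PowerSeries.constantCoeff G = 1) (h : MinRel G R 1)
    (hQd : Q.natDegree ≤ e - 1) : False := by
  have hlc : R.coeff 1 ≠ 0 := by
    rw [← h.deg]; exact leadingCoeff_ne_zero.2 h.ne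
  have hr0 := h.coeff_zero hG1
  have hrel : (R.coeff 0 : PowerSeries ℂ) + (R.coeff 1 : PowerSeries ℂ) * G = 0 := by
    have := h.rel
    rw [eval₂_eq_sum_range, h.deg] at this
    simpa [Finset.sum_range_succ] using this
  have hcop : IsCoprime (R.coeff 0) (R.coeff 1) := by
    obtain ⟨g, A, B, hg, hA, hB, u, v, huv⟩ := exists_coprime_fac (R.coeff 0) (R.coeff 1) hlc
    have hu : IsUnit g := by
      apply h.prim
      rw [C_dvd_iff_dvd_coeff]
      intro i
      rcases i with _ | _ | i
      · exact ⟨A, hA⟩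
      · exact ⟨B, hB⟩
      · rw [coeff_eq_zero_of_natDegree_lt (by rw [h.deg]; omega)]
        exact dvd_zero _
    rw [hA, hB]
    exact (isCoprime_mul_unit_left hu A B).2 ⟨u, v, huv⟩
  generalize R.coeff 0 = r0 at *
  generalize R.coeff 1 = r1 at *
  have hrelT := congrArg (PowerSeries.expand T hT) hrel
  rw [map_add, map_mul, map_zero, expand_coe, expand_coe] at hrelT
  have hpoly : (r0 + Q * r1) * r0.comp (X ^ T) = r1 * r1.comp (X ^ T) * X ^ (T * e) := by
    rw [← Polynomial.coe_inj]
    push_cast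
    linear_combination (r0.comp (X ^ T) : PowerSeries ℂ) * hrel - (r1 : PowerSeries ℂ) *
      (G - (Q : PowerSeries ℂ)) * hrelT + (r1 : PowerSeries ℂ) *
      ((r1.comp (X ^ T) : ℂ[X]) : PowerSeries ℂ) * hG
  have hcopT : IsCoprime (r0.comp (X ^ T)) (r1.comp (X ^ T)) := by
    obtain ⟨u, v, huv⟩ := hcop
    refine ⟨u.comp (X ^ T), v.comp (X ^ T), ?_⟩
    rw [← mul_comp, ← mul_comp, ← add_comp, huv, one_comp]
  have h00 : r0.coeff 0 ≠ 0 := by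
    intro h0
    have h1 : r1.coeff 0 = 0 := by
      have := congrArg PowerSeries.constantCoeff hrel
      rw [map_add, map_mul, hG1, mul_one, map_zero, Polynomial.constantCoeff_coe,
        Polynomial.constantCoeff_coe] at this
      simpa [h0] using this
    exact not_isUnit_X (hcop.isUnit_of_dvd' (X_dvd_iff.2 h0) (X_dvd_iff.2 h1))
  have hcopX : IsCoprime (r0.comp (X ^ T)) (X ^ (T * e) : ℂ[X]) := by
    apply IsCoprime.pow_right
    rw [isCoprime_comm, (irreducible_X : Irreducible (X : ℂ[X])).coprime_iff_not_dvd, X_dvd_iff,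
      coeff_zero_eq_eval_zero, eval_comp, eval_pow, eval_X, zero_pow hT, ← coeff_zero_eq_eval_zero]
    exact h00
  have hd1 : r0.comp (X ^ T) ∣ r1 := by
    have : r0.comp (X ^ T) ∣ r1 * r1.comp (X ^ T) * X ^ (T * e) := ⟨_, by rw [← hpoly, mul_comm]⟩
    exact hcopT.dvd_of_dvd_mul_right (hcopX.dvd_of_dvd_mul_right this)
  have hd2 : r1 ∣ r0.comp (X ^ T) := by
    have : r1 ∣ r0 * r0.comp (X ^ T) :=
      ⟨r1.comp (X ^ T) * X ^ (T * e) - Q * r0.comp (X ^ T), by linear_combination hpoly⟩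
    exact hcop.symm.dvd_of_dvd_mul_left this
  have hr0T := comp_X_pow_ne hT hr0
  have hr1T := comp_X_pow_ne hT hlc
  have dT : ∀ p : ℂ[X], (p.comp (X ^ T)).natDegree = p.natDegree * T := by
    intro p; rw [natDegree_comp, natDegree_X_pow]
  have hdeg : r1.natDegree = r0.natDegree * T := by
    rw [← dT]
    exact le_antisymm (natDegree_le_of_dvd hd2 hr0T) (natDegree_le_of_dvd hd1 hlc)
  have hL := congrArg natDegree hpoly
  rw [natDegree_mul (mul_ne_zero hlc hr1T) (pow_ne_zero _ X_ne_zero), natDegree_mul hlc hr1T, dT,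
    natDegree_X_pow, hdeg] at hL
  have hle : ((r0 + Q * r1) * r0.comp (X ^ T)).natDegree ≤
      max r0.natDegree (e - 1 + r0.natDegree * T) + r0.natDegree * T := by
    refine natDegree_mul_le.trans (add_le_add ((natDegree_add_le _ _).trans (max_le_max le_rfl ?_))
      (dT _).le)
    refine natDegree_mul_le.trans ?_
    rw [hdeg]; omega
  rw [hL] at hle
  obtain ⟨e', rfl⟩ : ∃ e', e = e' + 1 := ⟨e - 1, by omega⟩
  generalize r0.natDegree = n at hle
  have i1 : n ≤ n * T := Nat.le_mul_of_pos_right _ (by omega)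
  have i2 : n * T ≤ n * T * T := Nat.le_mul_of_pos_right _ (by omega)
  have i3 : e' + 1 ≤ T * (e' + 1) := Nat.le_mul_of_pos_left _ (by omega)
  have : max n (e' + 1 - 1 + n * T) ≤ e' + n * T := by omega
  omega

/-- functional transcendence -/
theorem G_transc (hT2 : 2 ≤ T) (he : 1 ≤ e) (hT : T ≠ 0)
    (hG : (G - (Q : PowerSeries ℂ)) * PowerSeries.expand T hT G =
    PowerSeries.X ^ (T * e)) (hG1 : PowerSeries.constantCoeff G = 1)
    (hQd : Q.natDegree ≤ e - 1) {k : ℕ} (hk : 1 ≤ k) (hQ1 : Q.eval 1 = k)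
    (R₀ : ℂ[X][X]) (h0 : R₀ ≠ 0) : R₀.eval₂ iotaP G ≠ 0 := by
  intro hrel
  obtain ⟨R, d, h⟩ := exists_minRel G R₀ h0 hrel
  have hpos := h.pos
  rcases (by omega : d = 1 ∨ d = 2 ∨ 3 ≤ d) with rfl | rfl | hd
  · exact no_one hT2 he hT hG hG1 h hQd
  · exact no_two hT2 hT hG hG1 h
  · exact no_ge_three hT2 hT hG hG1 h hk hQ1 hd

end functional

section liouville

set_option linter.unusedSectionVars false

variable {K : Type*} [Field K] [CharZero K]

/-- size control: `D ^ m * x` is integral and all conjugates are at most `L * B ^ m` -/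
def Sz (D : ℕ) (B : ℝ) (x : K) (m : ℕ) (L : ℝ) : Prop :=
  IsIntegral ℤ ((D : K) ^ m * x) ∧ ∀ σ : K →ₐ[ℚ] ℂ, ‖σ x‖ ≤ L * B ^ m

variable {D : ℕ} {B : ℝ} {x y : K} {m m' : ℕ} {L L' : ℝ}

lemma natCast_integral (D : ℕ) : IsIntegral ℤ (D : K) := by
  have := isIntegral_algebraMap (R := ℤ) (A := K) (x := (D : ℤ))
  simpa using this

lemma Sz.mul (hL : 0 ≤ L) (hB : 1 ≤ B) (hx : Sz D B x m L) (hy : Sz D B y m' L') :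
    Sz D B (x * y) (m + m') (L * L') := by
  constructor
  · have := hx.1.mul hy.1
    rw [show (D : K) ^ m * x * ((D : K) ^ m' * y) = (D : K) ^ (m + m') * (x * y) by ring] at this
    exact this
  · intro σ
    rw [map_mul, norm_mul]
    calc ‖σ x‖ * ‖σ y‖ ≤ (L * B ^ m) * (L' * B ^ m') :=
          mul_le_mul (hx.2 σ) (hy.2 σ) (norm_nonneg _) (by positivity)
      _ = L * L' * B ^ (m + m') := by ring

lemma Sz.add (hx : Sz D B x m L) (hy : Sz D B y m L') : Sz D B (x + y) m (L + L') := by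
  constructor
  · rw [mul_add]; exact hx.1.add hy.1
  · intro σ
    rw [map_add, add_mul]
    exact (norm_add_le _ _).trans (add_le_add (hx.2 σ) (hy.2 σ))

lemma Sz.neg (hx : Sz D B x m L) : Sz D B (-x) m L := by
  constructor
  · rw [mul_neg]; exact hx.1.neg
  · intro σ
    rw [map_neg, norm_neg]; exact hx.2 σ

lemma Sz.mono (hB : 1 ≤ B) (hL' : 0 ≤ L') (hm : m ≤ m') (hL : L ≤ L') (hx : Sz D B x m L) :
    Sz D B x m' L' := by
  constructor
  · have := ((natCast_integral (K := K) D).pow (m' - m)).mul hx.1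
    rwa [← mul_assoc, ← pow_add, Nat.sub_add_cancel hm] at this
  · intro σ
    refine (hx.2 σ).trans ?_
    exact mul_le_mul hL (pow_le_pow_right₀ hB hm) (by positivity) hL'

lemma Sz.absorb (hB : 1 ≤ B) (hm : m + 1 ≤ m') (hL : L ≤ B) (hx : Sz D B x m L) :
    Sz D B x m' 1 := by
  have h1 : Sz D B x (m + 1) 1 := by
    constructor
    · have := ((natCast_integral (K := K) D)).mul hx.1
      rwa [← mul_assoc, ← pow_succ'] at this
    · intro σ
      refine (hx.2 σ).trans ?_
      rw [one_mul, pow_succ']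
      exact mul_le_mul_of_nonneg_right hL (by positivity)
  exact h1.mono hB zero_le_one hm le_rfl

lemma Sz.int (c : ℤ) : Sz D B (c : K) 0 (|c| : ℝ) := by
  constructor
  · rw [pow_zero, one_mul]; exact isIntegral_algebraMap (R := ℤ) (A := K) (x := c)
  · intro σ
    rw [map_intCast, pow_zero, mul_one, Complex.norm_intCast]

lemma Sz.one : Sz D B (1 : K) 0 1 := by
  have := Sz.int (K := K) (D := D) (B := B) 1
  simpa using this

lemma Sz.pow (hB : 1 ≤ B) (hx : Sz D B x m 1) (n : ℕ) : Sz D B (x ^ n) (m * n) 1 := by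
  induction n with
  | zero => simpa using Sz.one
  | succ n ih =>
    have := ih.mul zero_le_one hB hx
    rwa [← pow_succ, mul_one] at this

lemma Sz.sum {ι : Type*} (s : Finset ι) (f : ι → K) (l : ι → ℝ)
    (h : ∀ i ∈ s, Sz D B (f i) m (l i)) : Sz D B (∑ i ∈ s, f i) m (∑ i ∈ s, l i) := by
  classical
  induction s using Finset.induction_on with
  | empty =>
    constructor
    · simpa using isIntegral_zero
    · intro σ; simp
  | insert a s ha ih =>
    rw [Finset.sum_insert ha, Finset.sum_insert ha]
    exact (h a (by simp)).add (ih fun i hi => h i (by simp [hi]))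

lemma Sz.liouville [FiniteDimensional ℚ K] (hD : 1 ≤ D) (hB : 1 ≤ B) (hL : 1 ≤ L) (hx : Sz D B x m L)
    (hx0 : x ≠ 0) (τ : K →ₐ[ℚ] ℂ) :
    1 ≤ ‖τ x‖ * (L * (D * B) ^ m) ^ (Fintype.card (K →ₐ[ℚ] ℂ)) := by
  classical
  have hD0 : (D : K) ^ m ≠ 0 := pow_ne_zero _ (by exact_mod_cast (by omega : D ≠ 0))
  set w := (D : K) ^ m * x with hw
  have hw0 : w ≠ 0 := mul_ne_zero hD0 hx0
  have hDR : (1 : ℝ) ≤ (D : ℝ) ^ m := one_le_pow₀ (by exact_mod_cast hD)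
  have hBm : 1 ≤ B ^ m := one_le_pow₀ hB
  have hσ : ∀ σ : K →ₐ[ℚ] ℂ, ‖σ w‖ = D ^ m * ‖σ x‖ := by
    intro σ; rw [hw, map_mul, map_pow, map_natCast, norm_mul, norm_pow, Complex.norm_natCast]
  have hN := Algebra.norm_eq_prod_embeddings ℚ ℂ w
  have hintg : IsIntegral ℤ (Algebra.norm ℚ w) := Algebra.isIntegral_norm ℚ hx.1
  obtain ⟨c, hc⟩ := IsIntegrallyClosed.isIntegral_iff.1 hintg
  have hc0 : c ≠ 0 := by
    rintro rfl
    rw [map_zero] at hc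
    exact (Algebra.norm_ne_zero_iff.2 hw0) hc.symm
  have h1 : (1 : ℝ) ≤ ∏ σ : K →ₐ[ℚ] ℂ, ‖σ w‖ := by
    rw [← norm_prod, ← hN, ← hc]
    simp only [algebraMap_int_eq, eq_intCast, eq_ratCast, Rat.cast_intCast, Complex.norm_intCast]
    exact_mod_cast Int.one_le_abs hc0
  have hle : ∀ σ : K →ₐ[ℚ] ℂ, ‖σ w‖ ≤ L * (D * B) ^ m := by
    intro σ
    rw [hσ, mul_pow]
    have := mul_le_mul_of_nonneg_left (hx.2 σ) (by positivity : (0 : ℝ) ≤ D ^ m)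
    linarith
  have hA1 : (D : ℝ) ^ m ≤ L * (D * B) ^ m := by
    rw [mul_pow]
    have : 1 * 1 ≤ L * B ^ m := mul_le_mul hL hBm zero_le_one (by linarith)
    nlinarith
  have hA0 : 0 ≤ L * ((D : ℝ) * B) ^ m := by linarith
  rw [← Finset.mul_prod_erase Finset.univ _ (Finset.mem_univ τ)] at h1
  have h2 : ∏ σ ∈ Finset.univ.erase τ, ‖σ w‖ ≤
      (L * ((D : ℝ) * B) ^ m) ^ (Finset.univ.erase τ).card := by
    refine (Finset.prod_le_prod (fun _ _ => norm_nonneg _) (fun σ _ => hle σ)).trans_eq ?_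
    rw [Finset.prod_const]
  have h3 : Fintype.card (K →ₐ[ℚ] ℂ) = (Finset.univ.erase τ).card + 1 := by
    rw [Finset.card_erase_add_one (Finset.mem_univ τ), Finset.card_univ]
  rw [h3, pow_succ]
  calc (1 : ℝ) ≤ ‖τ w‖ * ∏ σ ∈ Finset.univ.erase τ, ‖σ w‖ := h1
    _ ≤ ‖τ w‖ * (L * ((D : ℝ) * B) ^ m) ^ (Finset.univ.erase τ).card :=
        mul_le_mul_of_nonneg_left h2 (norm_nonneg _)
    _ = ‖τ x‖ * ((L * ((D : ℝ) * B) ^ m) ^ (Finset.univ.erase τ).card * D ^ m) := by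
        rw [hσ]; ring
    _ ≤ _ := by
        refine mul_le_mul_of_nonneg_left ?_ (norm_nonneg _)
        exact mul_le_mul_of_nonneg_left hA1 (by positivity)

/-- initial constants -/
lemma exists_consts [FiniteDimensional ℚ K] (b g : K) (l : ℝ) :
    ∃ (D : ℕ) (B : ℝ), 1 ≤ D ∧ 1 ≤ B ∧ l ≤ B ∧ Sz D B b 1 1 ∧ Sz D B g 1 1 := by
  have hden : ∀ a : K, ∃ n : ℕ, 1 ≤ n ∧ IsIntegral ℤ ((n : K) * a) := by
    intro a
    have halg : IsAlgebraic ℤ a :=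
      (IsFractionRing.isAlgebraic_iff ℤ ℚ K).2 (Algebra.IsAlgebraic.isAlgebraic a)
    obtain ⟨c, hc, hintg⟩ := halg.exists_integral_multiple
    refine ⟨c.natAbs, Int.natAbs_pos.2 hc, ?_⟩
    rw [zsmul_eq_mul] at hintg
    rcases Int.natAbs_eq c with h | h
    · rw [h] at hintg; simpa using hintg
    · rw [h] at hintg; simpa using hintg.neg
  obtain ⟨n₁, h1, hi1⟩ := hden b
  obtain ⟨n₂, h2, hi2⟩ := hden g
  set S : ℝ := ∑ σ : K →ₐ[ℚ] ℂ, (‖σ b‖ + ‖σ g‖) with hS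
  have hS0 : 0 ≤ S := Finset.sum_nonneg fun _ _ => by positivity
  have hSσ : ∀ σ : K →ₐ[ℚ] ℂ, ‖σ b‖ + ‖σ g‖ ≤ S := fun σ =>
    Finset.single_le_sum (f := fun σ : K →ₐ[ℚ] ℂ => ‖σ b‖ + ‖σ g‖)
      (fun _ _ => by positivity) (Finset.mem_univ σ)
  refine ⟨n₁ * n₂, S + 1 + |l|, Nat.mul_pos h1 h2, by linarith [abs_nonneg l],
    by linarith [le_abs_self l], ⟨?_, ?_⟩, ⟨?_, ?_⟩⟩
  · have := (natCast_integral (K := K) n₂).mul hi1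
    rw [pow_one]; push_cast
    rwa [show (n₁ : K) * n₂ * b = n₂ * (n₁ * b) by ring]
  · intro σ
    have := hSσ σ
    have := norm_nonneg (σ g)
    rw [one_mul, pow_one]; linarith [abs_nonneg l]
  · have := (natCast_integral (K := K) n₁).mul hi2
    rw [pow_one]; push_cast
    rwa [show (n₁ : K) * n₂ * g = n₁ * (n₂ * g) by ring]
  · intro σ
    have := hSσ σ
    have := norm_nonneg (σ b)
    rw [one_mul, pow_one]; linarith [abs_nonneg l]

/-- the orbit pair -/
noncomputable def orb (T e : ℕ) (Q : ℤ[X]) (b g : K) : ℕ → K × K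
  | 0 => (g, 1)
  | n + 1 => (b ^ (T * e * T ^ n) * (orb T e Q b g n).2,
      (orb T e Q b g n).1 - aeval (b ^ T ^ n) Q * (orb T e Q b g n).2)

/-- sum of absolute values of coefficients -/
noncomputable def LQ (Q : ℤ[X]) : ℝ := ∑ i ∈ Finset.range (Q.natDegree + 1), (|Q.coeff i| : ℝ)

lemma LQ_nonneg (Q : ℤ[X]) : 0 ≤ LQ Q := Finset.sum_nonneg fun _ _ => abs_nonneg _

lemma Sz.aeval (hB : 1 ≤ B) (hx : Sz D B x m 1) (Q : ℤ[X]) (n : ℕ) (hQ : Q.natDegree ≤ n) :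
    Sz D B (aeval x Q) (m * n) (LQ Q) := by
  rw [aeval_eq_sum_range]
  refine Sz.sum _ _ _ fun i hi => ?_
  have hi' : i ≤ n := by have := Finset.mem_range.1 hi; omega
  rw [zsmul_eq_mul]
  refine ((Sz.int (Q.coeff i)).mul (abs_nonneg _) hB (hx.pow hB i)).mono hB (abs_nonneg _) ?_ ?_
  · rw [zero_add]; exact Nat.mul_le_mul_left _ hi'
  · rw [mul_one]

lemma orb_sz {T e : ℕ} {Q : ℤ[X]} {b g : K} (hT : 2 ≤ T) (he : 1 ≤ e) (hQ : Q.natDegree ≤ e - 1)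
    (hB : 1 ≤ B) (hLB : LQ Q + 1 ≤ B) (hb : Sz D B b 1 1) (hg : Sz D B g 1 1) (n : ℕ) :
    Sz D B (orb T e Q b g n).1 (2 * T * e * T ^ n) 1 ∧
      Sz D B (orb T e Q b g n).2 (2 * T * e * T ^ n) 1 := by
  induction n with
  | zero =>
    constructor
    · refine hg.mono hB zero_le_one ?_ le_rfl
      have : 1 ≤ T * e := Nat.mul_pos (by omega) he
      rw [pow_zero, mul_one, mul_assoc]; omega
    · exact Sz.one.mono hB zero_le_one (Nat.zero_le _) le_rfl
  | succ n ih =>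
    obtain ⟨ih1, ih2⟩ := ih
    have hTn : 1 ≤ T ^ n := Nat.one_le_pow _ _ (by omega)
    have hbig : 4 * (T * e * T ^ n) ≤ 2 * T * e * T ^ (n + 1) := by
      rw [pow_succ]; nlinarith [Nat.zero_le (T * e * T ^ n)]
    constructor
    · have := (hb.pow hB (T * e * T ^ n)).mul zero_le_one hB ih2
      refine this.mono hB zero_le_one ?_ (by norm_num)
      rw [show 2 * T * e * T ^ n = 2 * (T * e * T ^ n) by ring]
      refine le_trans ?_ hbig
      omega
    · have h1 : Sz D B (aeval (b ^ T ^ n) Q) (1 * T ^ n * (e - 1)) (LQ Q) :=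
        (hb.pow hB (T ^ n)).aeval hB Q _ hQ
      have h2 := (h1.mul (LQ_nonneg Q) hB ih2).neg
      rw [mul_one] at h2
      have h3 := (ih1.mono (m' := 1 * T ^ n * (e - 1) + 2 * T * e * T ^ n) hB zero_le_one
        (by omega) le_rfl).add h2
      rw [← sub_eq_add_neg] at h3
      refine h3.absorb hB ?_ (by linarith)
      obtain ⟨e', rfl⟩ : ∃ e', e = e' + 1 := ⟨e - 1, by omega⟩
      rw [Nat.add_sub_cancel]
      have h5 : T ^ n * (e' + 1) ≤ T * (e' + 1) * T ^ n := by
        nlinarith [Nat.zero_le (T ^ n * (e' + 1))]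
      nlinarith

end liouville

section mahler

lemma Ev.unique {p : PowerSeries ℂ} {z v w : ℂ} (h : Ev p z v) (h' : Ev p z w) : v = w := by
  rw [← h.2, h'.2]

lemma Ev.approx {p : PowerSeries ℂ} {z z₀ v v₀ : ℂ} (h₀ : Ev p z₀ v₀) (hz₀ : z₀ ≠ 0)
    (hz : ‖z‖ ≤ ‖z₀‖) (h : Ev p z v) :
    ‖v - PowerSeries.constantCoeff p‖ ≤
      ‖z‖ * (‖z₀‖⁻¹ * ∑' n, ‖PowerSeries.coeff n p * z₀ ^ n‖) := by
  have hp0 : 0 < ‖z₀‖ := norm_pos_iff.2 hz₀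
  have hs : Summable fun n => PowerSeries.coeff n p * z ^ n := h.1.of_norm
  have h1 : v - PowerSeries.constantCoeff p = ∑' n, PowerSeries.coeff (n + 1) p * z ^ (n + 1) := by
    rw [← h.2, hs.tsum_eq_zero_add]
    simp
  have hb : ∀ n, ‖PowerSeries.coeff (n + 1) p * z ^ (n + 1)‖ ≤
      ‖z‖ * ‖z₀‖⁻¹ * ‖PowerSeries.coeff (n + 1) p * z₀ ^ (n + 1)‖ := by
    intro n
    rw [norm_mul, norm_mul, norm_pow, norm_pow]
    have h2 : ‖z‖ ^ n ≤ ‖z₀‖ ^ n := pow_le_pow_left₀ (norm_nonneg _) hz n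
    calc ‖PowerSeries.coeff (n + 1) p‖ * ‖z‖ ^ (n + 1)
        = ‖PowerSeries.coeff (n + 1) p‖ * ‖z‖ * ‖z‖ ^ n := by ring
      _ ≤ ‖PowerSeries.coeff (n + 1) p‖ * ‖z‖ * ‖z₀‖ ^ n :=
          mul_le_mul_of_nonneg_left h2 (by positivity)
      _ = ‖z‖ * ‖z₀‖⁻¹ * (‖PowerSeries.coeff (n + 1) p‖ * ‖z₀‖ ^ (n + 1)) := by
          rw [pow_succ]; field_simp
  have hs1 := (summable_nat_add_iff 1).2 h₀.1
  rw [h1]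
  refine (tsum_of_norm_bounded (hs1.mul_left (‖z‖ * ‖z₀‖⁻¹)).hasSum hb).trans ?_
  rw [tsum_mul_left, ← mul_assoc]
  refine mul_le_mul_of_nonneg_left ?_ (by positivity)
  rw [h₀.1.tsum_eq_zero_add]
  have := norm_nonneg (PowerSeries.coeff 0 p * z₀ ^ 0)
  linarith

lemma Ev.tendsto {p : PowerSeries ℂ} {z₀ : ℂ} (hz₀ : z₀ ≠ 0) (z v : ℕ → ℂ)
    (h0 : z 0 = z₀) (hz : ∀ n, ‖z n‖ ≤ ‖z₀‖) (hlim : Filter.Tendsto z Filter.atTop (nhds 0))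
    (h : ∀ n, Ev p (z n) (v n)) :
    Filter.Tendsto v Filter.atTop (nhds (PowerSeries.constantCoeff p)) := by
  rw [tendsto_iff_norm_sub_tendsto_zero]
  have h1 : Filter.Tendsto (fun n => ‖z n‖ * (‖z₀‖⁻¹ * ∑' n, ‖PowerSeries.coeff n p * z₀ ^ n‖))
      Filter.atTop (nhds 0) := by
    have := hlim.norm.mul_const (‖z₀‖⁻¹ * ∑' n, ‖PowerSeries.coeff n p * z₀ ^ n‖)
    simpa using this
  have h2 : Ev p z₀ (v 0) := by rw [← h0]; exact h 0
  exact squeeze_zero (fun _ => norm_nonneg _) (fun n => Ev.approx h2 hz₀ (hz n) (h n)) h1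

lemma Ev.shift (E : PowerSeries ℂ) (hE : E ≠ 0) (M : ℕ) (hM : ∀ i < M, PowerSeries.coeff i E = 0) :
    ∃ s E₁, M ≤ s ∧ PowerSeries.constantCoeff E₁ ≠ 0 ∧
      ∀ z v, z ≠ 0 → Ev E z v → Ev E₁ z (v / z ^ s) := by
  classical
  have hex : ∃ n, PowerSeries.coeff n E ≠ 0 := by
    by_contra hne
    push Not at hne
    exact hE (PowerSeries.ext fun n => by rw [hne n, map_zero])
  refine ⟨Nat.find hex, PowerSeries.mk fun n => PowerSeries.coeff (n + Nat.find hex) E, ?_, ?_, ?_⟩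
  · by_contra hlt
    exact Nat.find_spec hex (hM _ (by omega))
  · rw [← PowerSeries.coeff_zero_eq_constantCoeff_apply, PowerSeries.coeff_mk, zero_add]
    exact Nat.find_spec hex
  · intro z v hz h
    set s := Nat.find hex with hs
    have hterm : ∀ n, PowerSeries.coeff n
        (PowerSeries.mk fun n => PowerSeries.coeff (n + s) E) * z ^ n =
        (PowerSeries.coeff (n + s) E * z ^ (n + s)) / z ^ s := by
      intro n
      rw [PowerSeries.coeff_mk, pow_add]
      field_simp
    have hsum : Summable fun n => PowerSeries.coeff n E * z ^ n := h.1.of_norm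
    constructor
    · simp_rw [hterm, norm_div]
      exact ((summable_nat_add_iff s).2 h.1).div_const _
    · simp_rw [hterm]
      rw [tsum_div_const, ← h.2, ← hsum.sum_add_tsum_nat_add s, Finset.sum_eq_zero, zero_add]
      intro i hi
      have := Nat.find_min hex (Finset.mem_range.1 hi)
      push Not at this
      rw [this, zero_mul]

/-- the auxiliary series -/
noncomputable def auxE {A : Type*} [CommRing A] (N : ℕ) (r : Fin (N + 1) × Fin (N + 1) → ℤ)
    (h y : PowerSeries A) : PowerSeries A :=
  ∑ p, ((r p : ℤ) : PowerSeries A) * (PowerSeries.X ^ (p.1 : ℕ) * h ^ (p.2 : ℕ) * y ^ (N - p.2))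

lemma exists_aux (N : ℕ) (hN : 1 ≤ N) (h y : PowerSeries ℤ) :
    ∃ r : Fin (N + 1) × Fin (N + 1) → ℤ, r ≠ 0 ∧
      ∀ i < N * N, PowerSeries.coeff i (auxE N r h y) = 0 := by
  obtain ⟨r, hr, hA, -⟩ := Int.Matrix.exists_ne_zero_int_vec_norm_le
    (Matrix.of fun (i : Fin (N * N)) (p : Fin (N + 1) × Fin (N + 1)) =>
      PowerSeries.coeff (i : ℕ) (PowerSeries.X ^ (p.1 : ℕ) * h ^ (p.2 : ℕ) * y ^ (N - p.2)))
    (by simp; nlinarith) (by simp; omega)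
  refine ⟨r, hr, fun i hi => ?_⟩
  have := congrFun hA ⟨i, hi⟩
  rw [Matrix.mulVec, dotProduct] at this
  simp only [Matrix.of_apply, Pi.zero_apply] at this
  rw [auxE, map_sum, ← this]
  refine Finset.sum_congr rfl fun p _ => ?_
  rw [show ((r p : ℤ) : PowerSeries ℤ) = PowerSeries.C (r p) by simp, PowerSeries.coeff_C_mul,
    mul_comm]

lemma auxE_map (N : ℕ) (r : Fin (N + 1) × Fin (N + 1) → ℤ) (h y : PowerSeries ℤ) :
    PowerSeries.map (Int.castRingHom ℂ) (auxE N r h y) =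
      auxE N r (PowerSeries.map (Int.castRingHom ℂ) h) (PowerSeries.map (Int.castRingHom ℂ) y) := by
  simp [auxE, map_sum]

lemma auxE_ev (N : ℕ) (r : Fin (N + 1) × Fin (N + 1) → ℤ) {h y : PowerSeries ℂ} {z u v : ℂ}
    (hh : Ev h z u) (hy : Ev y z v) :
    Ev (auxE N r h y) z (∑ p, (r p : ℂ) * (z ^ (p.1 : ℕ) * u ^ (p.2 : ℕ) * v ^ (N - p.2))) := by
  refine Ev.sum _ _ _ fun p _ => ?_
  have h1 := Ev.poly (C (r p : ℂ)) z
  have h2 := Ev.poly (X ^ (p.1 : ℕ)) z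
  rw [Polynomial.coe_C, eval_C] at h1
  rw [Polynomial.coe_pow, Polynomial.coe_X, eval_pow, eval_X] at h2
  have h3 := h1.mul ((h2.mul (hh.pow p.2)).mul (hy.pow (N - p.2)))
  rwa [show (PowerSeries.C (r p : ℂ)) = ((r p : ℤ) : PowerSeries ℂ) by simp] at h3

lemma auxE_ne (N : ℕ) (r : Fin (N + 1) × Fin (N + 1) → ℤ) (hr : r ≠ 0) {h y G : PowerSeries ℂ}
    (hG : h = G * y) (hy : y ≠ 0) (htr : ∀ R : ℂ[X][X], R ≠ 0 → R.eval₂ iotaP G ≠ 0) :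
    auxE N r h y ≠ 0 := by
  classical
  set R : ℂ[X][X] := ∑ p : Fin (N + 1) × Fin (N + 1),
    C (C (r p : ℂ) * X ^ (p.1 : ℕ)) * X ^ (p.2 : ℕ) with hR
  have hRne : R ≠ 0 := by
    intro h0
    apply hr
    funext q
    have h1 := congrArg (fun P => (P.coeff (q.2 : ℕ)).coeff (q.1 : ℕ)) h0
    simp only [hR, finsetSum_coeff, coeff_C_mul_X_pow, coeff_zero] at h1
    rw [Finset.sum_eq_single q] at h1
    · simpa using h1
    · intro p _ hpq
      split_ifs with h2
      · rw [coeff_C_mul_X_pow]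
        split_ifs with h3
        · exact absurd (Prod.ext (Fin.ext h3.symm) (Fin.ext h2.symm)) hpq
        · rfl
      · simp
    · simp
  have hE : auxE N r h y = y ^ N * R.eval₂ iotaP G := by
    rw [auxE, hR, eval₂_finsetSum, Finset.mul_sum]
    refine Finset.sum_congr rfl fun p _ => ?_
    rw [eval₂_mul, eval₂_C, eval₂_pow, eval₂_X, map_mul, hG]
    have e1 : iotaP (C (r p : ℂ)) = ((r p : ℤ) : PowerSeries ℂ) := by simp
    have e2 : iotaP (X ^ (p.1 : ℕ)) = (PowerSeries.X : PowerSeries ℂ) ^ (p.1 : ℕ) := by simp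
    have e3 : y ^ N = y ^ (p.2 : ℕ) * y ^ (N - p.2) := by
      rw [← pow_add, Nat.add_sub_cancel' (Nat.lt_succ_iff.1 p.2.2)]
    rw [e1, e2, e3, mul_pow]; ring
  rw [hE]
  exact mul_ne_zero (pow_ne_zero _ hy) (htr R hRne)

variable {T e : ℕ} {Q : ℤ[X]} {h : PowerSeries ℤ} {H : ℂ → ℂ}

/-- all the standing assumptions -/
structure Setup (T e : ℕ) (Q : ℤ[X]) (h : PowerSeries ℤ) (H : ℂ → ℂ) : Prop where
  hT : 2 ≤ T
  he : 1 ≤ e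
  hQd : Q.natDegree ≤ e - 1
  hQ1 : ∃ k : ℕ, 1 ≤ k ∧ Q.eval 1 = k
  hh0 : PowerSeries.constantCoeff h = 1
  hT0 : T ≠ 0
  heq : h = (Q : PowerSeries ℤ) * PowerSeries.expand T hT0 h + PowerSeries.X ^ (T * e) *
      PowerSeries.expand T hT0 (PowerSeries.expand T hT0 h)
  ev : ∀ z : ℂ, ‖z‖ < 1 → Ev (PowerSeries.map (Int.castRingHom ℂ) h) z (H z)

lemma coe_map_int (Q : ℤ[X]) : PowerSeries.map (Int.castRingHom ℂ) (Q : PowerSeries ℤ) =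
    ((Q.map (Int.castRingHom ℂ) : ℂ[X]) : PowerSeries ℂ) := by
  ext i; simp

lemma Setup.heqC (S : Setup T e Q h H) : PowerSeries.map (Int.castRingHom ℂ) h =
    ((Q.map (Int.castRingHom ℂ) : ℂ[X]) : PowerSeries ℂ) *
      PowerSeries.expand T S.hT0 (PowerSeries.map (Int.castRingHom ℂ) h) +
    PowerSeries.X ^ (T * e) * PowerSeries.expand T S.hT0
      (PowerSeries.expand T S.hT0 (PowerSeries.map (Int.castRingHom ℂ) h)) := by
  conv_lhs => rw [S.heq]
  simp only [map_add, map_mul, map_pow, PowerSeries.map_X, PowerSeries.map_expand, coe_map_int]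

lemma Setup.hc0 (S : Setup T e Q h H) :
    PowerSeries.constantCoeff (PowerSeries.map (Int.castRingHom ℂ) h) = 1 := by
  rw [← PowerSeries.coeff_zero_eq_constantCoeff_apply, PowerSeries.coeff_map,
    PowerSeries.coeff_zero_eq_constantCoeff_apply, S.hh0]
  simp

lemma norm_pow_lt_one {z : ℂ} (hz : ‖z‖ < 1) {n : ℕ} (hn : n ≠ 0) : ‖z ^ n‖ < 1 := by
  rw [norm_pow]; exact pow_lt_one₀ (norm_nonneg _) hz hn

lemma Setup.H_eq (S : Setup T e Q h H) (z : ℂ) (hz : ‖z‖ < 1) :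
    H z = aeval z Q * H (z ^ T) + z ^ (T * e) * H ((z ^ T) ^ T) := by
  have hz1 := norm_pow_lt_one hz S.hT0
  have h1 := S.ev z hz
  have h2 := (S.ev _ hz1).expand S.hT0
  have h3 := ((S.ev _ (norm_pow_lt_one hz1 S.hT0)).expand S.hT0).expand S.hT0
  have h4 := Ev.poly (Q.map (Int.castRingHom ℂ)) z
  have h5 := Ev.poly (X ^ (T * e)) z
  rw [Polynomial.coe_pow, Polynomial.coe_X, eval_pow, eval_X] at h5
  have h6 := (h4.mul h2).add (h5.mul h3)
  rw [← S.heqC] at h6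
  rw [h1.unique h6, eval_map]
  rfl

lemma Setup.transc (S : Setup T e Q h H) : ∃ G : PowerSeries ℂ,
    PowerSeries.map (Int.castRingHom ℂ) h =
      G * PowerSeries.expand T S.hT0 (PowerSeries.map (Int.castRingHom ℂ) h) ∧
    ∀ R : ℂ[X][X], R ≠ 0 → R.eval₂ iotaP G ≠ 0 := by
  set hc := PowerSeries.map (Int.castRingHom ℂ) h with hhc
  set y := PowerSeries.expand T S.hT0 hc with hy
  have hc1 : PowerSeries.constantCoeff hc = 1 := S.hc0
  have hy1 : PowerSeries.constantCoeff y = 1 := by rw [hy, PowerSeries.constantCoeff_expand, hc1]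
  have hyi : y⁻¹ * y = 1 := PowerSeries.inv_mul_cancel _ (by rw [hy1]; exact one_ne_zero)
  have hG : hc = hc * y⁻¹ * y := by rw [mul_assoc, hyi, mul_one]
  refine ⟨hc * y⁻¹, hG, ?_⟩
  set G := hc * y⁻¹ with hGdef
  obtain ⟨k, hk, hQ1⟩ := S.hQ1
  have heq := S.heqC
  rw [← hhc, ← hy] at heq
  have hyG : y = PowerSeries.expand T S.hT0 G * PowerSeries.expand T S.hT0 y := by
    conv_lhs => rw [hy, hG, map_mul]
  have hy0 : y ≠ 0 := by intro h0; rw [h0] at hy1; simp at hy1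
  have hyT0 : PowerSeries.expand T S.hT0 y ≠ 0 := by
    intro h0; rw [h0, mul_zero] at hyG; exact hy0 hyG
  refine G_transc (e := e) (Q := Q.map (Int.castRingHom ℂ)) S.hT S.he S.hT0 ?_ ?_ ?_ hk ?_
  · apply mul_right_cancel₀ hyT0
    have e1 : (G - ((Q.map (Int.castRingHom ℂ) : ℂ[X]) : PowerSeries ℂ)) * y =
        PowerSeries.X ^ (T * e) * PowerSeries.expand T S.hT0 y := by
      rw [sub_mul, ← hG]
      linear_combination heq
    rw [mul_assoc, ← hyG, e1]
  · have := congrArg PowerSeries.constantCoeff hG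
    rw [map_mul, hc1, hy1, mul_one] at this
    exact this.symm
  · exact natDegree_map_le.trans S.hQd
  · rw [eval_map, eval₂_at_one, hQ1]; simp

lemma orb_val {K : Type*} [Field K] [CharZero K] (S : Setup T e Q h H) (τ : K →ₐ[ℚ] ℂ) {b g : K}
    (hb : ‖τ b‖ < 1) (hg : τ g * H (τ b ^ T) = H (τ b)) (n : ℕ) :
    ∃ c : ℂ, ‖c‖ ≤ 1 ∧ (τ b ≠ 0 → c ≠ 0) ∧
      τ (orb T e Q b g n).1 * H (τ b ^ T) = c * H (τ b ^ T ^ n) ∧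
      τ (orb T e Q b g n).2 * H (τ b ^ T) = c * H ((τ b ^ T ^ n) ^ T) := by
  induction n with
  | zero => exact ⟨1, by simp, by simp, by simpa [orb] using hg, by simp [orb]⟩
  | succ n ih =>
    obtain ⟨c, hc1, hc0, h1, h2⟩ := ih
    refine ⟨c * τ b ^ (T * e * T ^ n), ?_, ?_, ?_, ?_⟩
    · rw [norm_mul, norm_pow]
      exact mul_le_one₀ hc1 (by positivity) (pow_le_one₀ (norm_nonneg _) hb.le)
    · intro h; exact mul_ne_zero (hc0 h) (pow_ne_zero _ h)
    · rw [orb, map_mul, map_pow, pow_succ T n, pow_mul (τ b) (T ^ n) T]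
      linear_combination τ b ^ (T * e * T ^ n) * h2
    · have hz : ‖τ b ^ T ^ n‖ < 1 := norm_pow_lt_one hb (pow_ne_zero _ S.hT0)
      have hH := S.H_eq _ hz
      have ha : τ (aeval (b ^ T ^ n) Q) = aeval (τ b ^ T ^ n) Q := by
        rw [← map_pow]
        exact (aeval_algHom_apply (τ.restrictScalars ℤ) (b ^ T ^ n) Q).symm
      rw [orb, map_sub, map_mul, ha, pow_succ T n, pow_mul (τ b) (T ^ n) T]
      have hp : τ b ^ (T * e * T ^ n) = (τ b ^ T ^ n) ^ (T * e) := by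
        rw [← pow_mul]; ring_nf
      rw [hp]
      linear_combination h1 - aeval (τ b ^ T ^ n) Q * h2 + c * hH

theorem key_transc (S : Setup T e Q h H) (β : ℂ) (hβ : IsAlgebraic ℚ β) (h0 : 0 < ‖β‖)
    (h1 : ‖β‖ < 1) (hH : H (β ^ T) ≠ 0) : Transcendental ℚ (H β / H (β ^ T)) := by
  intro hγ
  set γ := H β / H (β ^ T) with hγdef
  have hβ0 : β ≠ 0 := norm_pos_iff.1 h0
  let K := IntermediateField.adjoin ℚ ({β, γ} : Set ℂ)
  have : FiniteDimensional ℚ K := by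
    refine IntermediateField.finiteDimensional_adjoin ?_
    intro x hx
    rcases hx with rfl | rfl
    · exact hβ.isIntegral
    · exact hγ.isIntegral
  let τ : K →ₐ[ℚ] ℂ := K.val
  let b : K := ⟨β, IntermediateField.subset_adjoin _ _ (by simp)⟩
  let g : K := ⟨γ, IntermediateField.subset_adjoin _ _ (by simp)⟩
  have hτb : τ b = β := rfl
  have hτg : τ g = γ := rfl
  obtain ⟨D, B, hD, hB, hLB, hb, hg⟩ := exists_consts b g (LQ Q + 1)
  set dg := Fintype.card (K →ₐ[ℚ] ℂ) with hdg
  set A : ℝ := (D * B) ^ ((2 * T * e + 1) * dg) with hA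
  have hDR : (1 : ℝ) ≤ D := by exact_mod_cast hD
  have hA0 : 0 < A := by positivity
  obtain ⟨N, hN, hNA⟩ : ∃ N : ℕ, 1 ≤ N ∧ ‖β‖ ^ N * A ≤ 1 / 2 := by
    obtain ⟨N, hN⟩ := exists_pow_lt_of_lt_one (by positivity : 0 < 1 / 2 / A) h1
    refine ⟨N + 1, by omega, ?_⟩
    have : ‖β‖ ^ (N + 1) ≤ ‖β‖ ^ N := pow_le_pow_of_le_one h0.le h1.le (by omega)
    rw [← le_div_iff₀ hA0]
    linarith
  obtain ⟨G, hG, htr⟩ := S.transc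
  obtain ⟨r, hr, hrc⟩ := exists_aux N hN h (PowerSeries.expand T S.hT0 h)
  set E := auxE N r (PowerSeries.map (Int.castRingHom ℂ) h)
    (PowerSeries.expand T S.hT0 (PowerSeries.map (Int.castRingHom ℂ) h)) with hE
  have hy0 : PowerSeries.expand T S.hT0 (PowerSeries.map (Int.castRingHom ℂ) h) ≠ 0 := by
    intro h0
    have := congrArg PowerSeries.constantCoeff h0
    rw [PowerSeries.constantCoeff_expand, S.hc0] at this
    simp at this
  have hE0 : E ≠ 0 := auxE_ne N r hr hG hy0 htr
  have hEc : ∀ i < N * N, PowerSeries.coeff i E = 0 := by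
    intro i hi
    rw [hE, ← PowerSeries.map_expand, ← auxE_map, PowerSeries.coeff_map, hrc i hi, map_zero]
  obtain ⟨s, E₁, hs, hE1, hEv⟩ := Ev.shift E hE0 (N * N) hEc
  set z : ℕ → ℂ := fun n => β ^ T ^ n with hz
  have hz1 : ∀ n, ‖z n‖ < 1 := fun n => norm_pow_lt_one h1 (pow_ne_zero _ S.hT0)
  have hz0 : ∀ n, z n ≠ 0 := fun n => pow_ne_zero _ hβ0
  set v : ℕ → ℂ := fun n => ∑ p : Fin (N + 1) × Fin (N + 1), (r p : ℂ) *
    (z n ^ (p.1 : ℕ) * H (z n) ^ (p.2 : ℕ) * H (z n ^ T) ^ (N - p.2)) with hv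
  have hvE : ∀ n, Ev E (z n) (v n) := fun n => auxE_ev N r (S.ev _ (hz1 n))
    ((S.ev _ (norm_pow_lt_one (hz1 n) S.hT0)).expand S.hT0)
  have hlim : Filter.Tendsto (fun n => v n / z n ^ s) Filter.atTop
      (nhds (PowerSeries.constantCoeff E₁)) := by
    refine Ev.tendsto hβ0 z _ (by simp [hz]) ?_ ?_ (fun n => hEv _ _ (hz0 n) (hvE n))
    · intro n
      rw [hz]; simp only [norm_pow]
      exact pow_le_of_le_one h0.le h1.le (pow_ne_zero _ S.hT0)
    · exact (tendsto_pow_atTop_nhds_zero_of_norm_lt_one h1).comp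
        (tendsto_pow_atTop_atTop_of_one_lt (by have := S.hT; omega))
  have ev1 : ∀ᶠ n in Filter.atTop, v n / z n ^ s ≠ 0 := hlim.eventually_ne hE1
  set C₀ : ℝ := ‖PowerSeries.constantCoeff E₁‖ + 1 with hC₀
  have ev2 : ∀ᶠ n in Filter.atTop, ‖v n / z n ^ s‖ < C₀ :=
    hlim.norm.eventually_lt_const (by rw [hC₀]; linarith)
  set L : ℝ := ∑ p : Fin (N + 1) × Fin (N + 1), (|r p| : ℝ) + 1 with hL
  have hL1 : 1 ≤ L := by
    have : 0 ≤ ∑ p : Fin (N + 1) × Fin (N + 1), (|r p| : ℝ) :=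
      Finset.sum_nonneg fun _ _ => abs_nonneg _
    rw [hL]; linarith
  set C₁ : ℝ := C₀ / ‖H (β ^ T)‖ ^ N * L ^ dg with hC₁
  have ev3 : ∀ᶠ n : ℕ in Filter.atTop, C₁ * (1 / 2 : ℝ) ^ n < 1 := by
    have : Filter.Tendsto (fun n : ℕ => C₁ * (1 / 2 : ℝ) ^ n) Filter.atTop (nhds (C₁ * 0)) :=
      (tendsto_pow_atTop_nhds_zero_of_lt_one (by norm_num) (by norm_num)).const_mul _
    rw [mul_zero] at this
    exact this.eventually_lt_const one_pos
  obtain ⟨n, hn1, hn2, hn3⟩ := (ev1.and (ev2.and ev3)).exists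
  set W : K := ∑ p : Fin (N + 1) × Fin (N + 1), ((r p : ℤ) : K) * ((b ^ T ^ n) ^ (p.1 : ℕ) *
    (orb T e Q b g n).1 ^ (p.2 : ℕ) * (orb T e Q b g n).2 ^ (N - p.2)) with hW
  obtain ⟨c, hc1, hc0, hX, hY⟩ := orb_val S τ (b := b) (g := g) h1
    (by rw [hτg, hτb, hγdef, div_mul_cancel₀ _ hH]) n
  rw [hτb] at hX hY hc0
  have hWv : τ W * H (β ^ T) ^ N = c ^ N * v n := by
    rw [hW, map_sum, Finset.sum_mul, hv, Finset.mul_sum]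
    refine Finset.sum_congr rfl fun p _ => ?_
    have hsplit : ∀ x : ℂ, x ^ N = x ^ (p.2 : ℕ) * x ^ (N - p.2) := fun x => by
      rw [← pow_add, Nat.add_sub_cancel' (Nat.lt_succ_iff.1 p.2.2)]
    rw [map_mul, map_mul, map_mul, map_pow, map_pow, map_pow, map_pow, map_intCast, hτb, hsplit,
      hsplit c]
    calc _ = (r p : ℂ) * ((β ^ T ^ n) ^ (p.1 : ℕ) *
          (τ (orb T e Q b g n).1 * H (β ^ T)) ^ (p.2 : ℕ) *
          (τ (orb T e Q b g n).2 * H (β ^ T)) ^ (N - p.2)) := by rw [mul_pow, mul_pow]; ring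
      _ = _ := by rw [hX, hY, mul_pow, mul_pow]; ring
  have hvn : v n ≠ 0 := by intro h; apply hn1; rw [h, zero_div]
  have hW0 : W ≠ 0 := by
    intro h
    rw [h, map_zero, zero_mul] at hWv
    exact mul_ne_zero (pow_ne_zero N (hc0 hβ0)) hvn hWv.symm
  have hSz : Sz D B W (N * T ^ n * (2 * T * e + 1)) L := by
    have hTe := orb_sz S.hT S.he S.hQd hB hLB hb hg n
    have : Sz D B W (N * T ^ n * (2 * T * e + 1))
        (∑ p : Fin (N + 1) × Fin (N + 1), (|r p| : ℝ)) := by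
      refine Sz.sum _ _ _ fun p _ => ?_
      have hp1 : (p.1 : ℕ) ≤ N := Nat.lt_succ_iff.1 p.1.2
      have hp2 : (p.2 : ℕ) ≤ N := Nat.lt_succ_iff.1 p.2.2
      have e1 := (((hb.pow hB (T ^ n)).pow hB (p.1 : ℕ)).mul zero_le_one hB
        (hTe.1.pow hB (p.2 : ℕ))).mul (by norm_num) hB (hTe.2.pow hB (N - p.2))
      have e2 := (Sz.int (D := D) (B := B) (K := K) (r p)).mul (abs_nonneg _) hB e1
      refine e2.mono hB (abs_nonneg _) ?_ (by simp)
      generalize T ^ n = M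
      have e3 : 2 * T * e * M * (p.2 : ℕ) + 2 * T * e * M * (N - p.2) = 2 * T * e * M * N := by
        rw [← mul_add, Nat.add_sub_cancel' hp2]
      have e4 : 1 * M * (p.1 : ℕ) ≤ M * N := by rw [one_mul]; exact Nat.mul_le_mul_left _ hp1
      calc _ = 1 * M * (p.1 : ℕ) + (2 * T * e * M * (p.2 : ℕ) + 2 * T * e * M * (N - p.2)) := by
            ring
        _ ≤ M * N + 2 * T * e * M * N := by rw [e3]; exact Nat.add_le_add_right e4 _
        _ = _ := by ring
    exact this.mono hB (by linarith) le_rfl (by rw [hL]; linarith)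
  have hLiou := hSz.liouville hD hB hL1 hW0 τ
  have hHp : 0 < ‖H (β ^ T)‖ ^ N := pow_pos (norm_pos_iff.2 hH) _
  have hWn : ‖τ W‖ ≤ C₀ / ‖H (β ^ T)‖ ^ N * (‖β‖ ^ N) ^ (N * T ^ n) := by
    rw [div_mul_eq_mul_div, le_div_iff₀ hHp, ← norm_pow, ← norm_mul, hWv, norm_mul, norm_pow]
    have a1 : ‖v n‖ = ‖v n / z n ^ s‖ * ‖z n ^ s‖ := by
      rw [← norm_mul, div_mul_cancel₀ _ (pow_ne_zero _ (hz0 n))]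
    have a2 : ‖z n ^ s‖ ≤ (‖β‖ ^ N) ^ (N * T ^ n) := by
      rw [hz]
      simp only
      rw [← pow_mul, norm_pow, ← pow_mul]
      refine pow_le_pow_of_le_one h0.le h1.le ?_
      calc N * (N * T ^ n) = T ^ n * (N * N) := by ring
        _ ≤ T ^ n * s := Nat.mul_le_mul_left _ hs
    have a3 : ‖c‖ ^ N ≤ 1 := pow_le_one₀ (norm_nonneg _) hc1
    have a4 : ‖v n‖ ≤ C₀ * (‖β‖ ^ N) ^ (N * T ^ n) := by
      rw [a1]
      exact mul_le_mul hn2.le a2 (norm_nonneg _) (by positivity)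
    calc ‖c‖ ^ N * ‖v n‖ ≤ 1 * ‖v n‖ := mul_le_mul_of_nonneg_right a3 (norm_nonneg _)
      _ ≤ _ := by rw [one_mul]; exact a4
  have hfin : ‖τ W‖ * (L * (D * B) ^ (N * T ^ n * (2 * T * e + 1))) ^ dg ≤ C₁ * (1 / 2) ^ n := by
    have b1 : (L * ((D : ℝ) * B) ^ (N * T ^ n * (2 * T * e + 1))) ^ dg =
        L ^ dg * A ^ (N * T ^ n) := by
      rw [mul_pow, hA, ← pow_mul, ← pow_mul]
      congr 2
      ring
    rw [b1]
    have hn : n ≤ N * T ^ n := by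
      have := (Nat.lt_pow_self (n := n) (a := T) (by have := S.hT; omega)).le
      nlinarith
    calc ‖τ W‖ * (L ^ dg * A ^ (N * T ^ n))
        ≤ (C₀ / ‖H (β ^ T)‖ ^ N * (‖β‖ ^ N) ^ (N * T ^ n)) * (L ^ dg * A ^ (N * T ^ n)) :=
          mul_le_mul_of_nonneg_right hWn (by positivity)
      _ = C₁ * (‖β‖ ^ N * A) ^ (N * T ^ n) := by rw [hC₁, mul_pow]; ring
      _ ≤ C₁ * (1 / 2) ^ (N * T ^ n) := by
          refine mul_le_mul_of_nonneg_left ?_ (by positivity)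
          exact pow_le_pow_left₀ (by positivity) hNA _
      _ ≤ C₁ * (1 / 2) ^ n := by
          refine mul_le_mul_of_nonneg_left ?_ (by positivity)
          exact pow_le_pow_of_le_one (by norm_num) (by norm_num) hn
  linarith

theorem nonvanish (S : Setup T e Q h H) (β : ℂ) (hβ : IsAlgebraic ℚ β) (h0 : 0 < ‖β‖)
    (h1 : ‖β‖ < 1) : H (β ^ T) ≠ 0 := by
  have hβ0 : β ≠ 0 := norm_pos_iff.1 h0
  set z : ℕ → ℂ := fun n => β ^ T ^ n with hz
  have hz1 : ∀ n, ‖z n‖ < 1 := fun n => norm_pow_lt_one h1 (pow_ne_zero _ S.hT0)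
  have hz0 : ∀ n, z n ≠ 0 := fun n => pow_ne_zero _ hβ0
  have hzs : ∀ n, z (n + 1) = z n ^ T := fun n => by
    rw [hz]; simp only; rw [pow_succ, pow_mul]
  have hlim : Filter.Tendsto (fun n => H (z n)) Filter.atTop (nhds 1) := by
    rw [← S.hc0]
    refine Ev.tendsto hβ0 z _ (by simp [hz]) ?_ ?_ (fun n => S.ev _ (hz1 n))
    · intro n
      rw [hz]; simp only [norm_pow]
      exact pow_le_of_le_one h0.le h1.le (pow_ne_zero _ S.hT0)
    · exact (tendsto_pow_atTop_nhds_zero_of_norm_lt_one h1).comp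
        (tendsto_pow_atTop_atTop_of_one_lt (by have := S.hT; omega))
  obtain ⟨m, hm⟩ := Filter.eventually_atTop.1 (hlim.eventually_ne one_ne_zero)
  have step : ∀ n, H (z (n + 1)) ≠ 0 → H (z n) ≠ 0 := by
    intro n hn hzero
    rw [hzs] at hn
    have := key_transc S (z n) (hβ.pow _) (norm_pos_iff.2 (hz0 n)) (hz1 n) hn
    rw [hzero, zero_div] at this
    exact this isAlgebraic_zero
  have all : ∀ j i, i + j = m + 1 → H (z i) ≠ 0 := by
    intro j
    induction j with
    | zero => intro i hi; exact hm i (by omega)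
    | succ j ih => intro i hi; exact step i (ih (i + 1) (by omega))
  have := all m 1 (by omega)
  simpa [hz] using this

end mahler

theorem mk_setup (t k : ℕ) (ht : 2 ≤ t) (hk : 1 ≤ k) (H : ℂ → ℂ)
    (hH : ∀ z : ℂ, ‖z‖ < 1 →
      Filter.Tendsto (fun n => Polynomial.aeval z (sternPoly t (sternAlpha k n)))
        Filter.atTop (nhds (H z))) :
    Setup (t ^ k) (eS t k) (pS t k) (hS fun n => sternPoly t (sternAlpha k n)) H := by
  have hT : 2 ≤ t ^ k := ht.trans (Nat.le_self_pow (by omega) t)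
  have he := eS_pos t k hk
  have hQ0 : (pS t k).coeff 0 = 1 := by rw [coeff_zero_eq_eval_zero]; exact pS_zero t k ht hk
  have f0 : sternPoly t (sternAlpha k 0) = 0 := stern_zero t k
  have f1 : sternPoly t (sternAlpha k 1) = 1 := stern_one t k
  have hf := stern_rec t k
  refine ⟨hT, he, pS_deg t k, ⟨k, hk, pS_one t k⟩, ?_, by omega,
    hS_eq (f := fun n => sternPoly t (sternAlpha k n)) hT he hQ0 f0 f1 hf (by omega),
    hS_ev (f := fun n => sternPoly t (sternAlpha k n)) hT he (pS_nonneg t k ht) hQ0 f0 f1 hf H hH⟩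
  rw [← PowerSeries.coeff_zero_eq_constantCoeff_apply, hS, PowerSeries.coeff_mk]
  simp only [zero_add]
  rw [f1]; simp

end HkAux

/-- For any algebraic number `α` with `0 < |α| < 1`, one has `H_k(α^{t^k}) ≠ 0` and
the quotient `H_k(α) / H_k(α^{t^k})` is transcendental, where `H_k(z)` is the limit
of `a_t(α_n; z)` as `n → ∞`. -/
theorem Hk_quotient_transcendental (t k : ℕ) (ht : 2 ≤ t) (hk : 1 ≤ k) (H : ℂ → ℂ)
    (hH : ∀ z : ℂ, ‖z‖ < 1 →
      Filter.Tendsto (fun n => Polynomial.aeval z (sternPoly t (sternAlpha k n)))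
        Filter.atTop (nhds (H z)))
    (α : ℂ) (halg : IsAlgebraic ℚ α) (h0 : 0 < ‖α‖) (h1 : ‖α‖ < 1) :
    H (α ^ t ^ k) ≠ 0 ∧ Transcendental ℚ (H α / H (α ^ t ^ k)) := by
  have S := HkAux.mk_setup t k ht hk H hH
  have hne := HkAux.nonvanish S α halg h0 h1
  exact ⟨hne, HkAux.key_transc S α halg h0 h1 hne⟩
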